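/- Let γ = (γ_1,…,γ_n) be a multi-index with all γ_i > 0 and let f be a continuous function on the closure of ℝ^n_+, even in each of its variables and integrable with the weight x^γ. Then for λ ≥ μ > 0 the iterated weighted spherical mean I^γ_f(x;λ,μ) = M^γ_λ[M^γ_μ[f(x)]] is expressed through a single integral of the weighted spherical mean: I^γ_f(x;λ,μ) = [2 Γ((n+|γ|)/2) / (√π Γ((n+|γ|−1)/2))] · (2λμ)^{−(n+|γ|−2)} ∫_{λ−μ}^{λ+μ} [(λ² − (r−μ)²)((r+μ)² − λ²)]^{(n+|γ|−3)/2} M^γ_f(x;r) r dr. -/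

import Mathlib

open MeasureTheory Real Set Filter

noncomputable section

/-- The normalizing constant `C(ν) = Γ((ν+1)/2)/(√π Γ(ν/2))` of the generalized translation. -/
def transC (ν : ℝ) : ℝ := Real.Gamma ((ν + 1) / 2) / (Real.sqrt π * Real.Gamma (ν / 2))

/-- One-dimensional generalized translation generated by the Bessel operator `B_ν`. -/
def genTrans1 (ν x y : ℝ) (f : ℝ → ℝ) : ℝ :=
  transC ν * ∫ φ in (0:ℝ)..π,
    f (Real.sqrt (x ^ 2 + y ^ 2 - 2 * x * y * Real.cos φ)) * Real.sin φ ^ (ν - 1)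

/-- Multidimensional generalized translation `ᵞT^y`, the composition of the one-dimensional
generalized translations with parameters `γ i` in each variable (written as one iterated
integral). -/
def gT {n : ℕ} (γ : Fin n → ℝ) (y : Fin n → ℝ) (f : (Fin n → ℝ) → ℝ) (x : Fin n → ℝ) : ℝ :=
  (∏ i, transC (γ i)) *
    ∫ φ in Set.pi Set.univ (fun _ : Fin n => Set.Icc (0 : ℝ) π),
      f (fun i => Real.sqrt ((x i) ^ 2 + (y i) ^ 2 - 2 * x i * y i * Real.cos (φ i))) *
        ∏ i, Real.sin (φ i) ^ (γ i - 1)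

/-- The surface measure of the unit sphere of `ℝ^n`, viewed as a measure on the ambient space. -/
def sphereMeasure (n : ℕ) : Measure (EuclideanSpace ℝ (Fin n)) :=
  Measure.map Subtype.val ((volume : Measure (EuclideanSpace ℝ (Fin n))).toSphere)

/-- The (open) part `S_1^+(n)` of the unit sphere lying in `ℝ^n_+`, as a subset of `ℝ^n`. -/
def spherePlus (n : ℕ) : Set (EuclideanSpace ℝ (Fin n)) := {θ | ∀ i, 0 < θ i}

/-- The weighted area `|S_1^+(n)|_γ = ∫_{S_1^+(n)} θ^γ dS`. -/
def wArea (n : ℕ) (γ : Fin n → ℝ) : ℝ :=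
  ∫ θ in spherePlus n, (∏ i, θ i ^ γ i) ∂(sphereMeasure n)

/-- The weighted spherical mean
`M^γ_r[f](x) = |S_1^+(n)|_γ⁻¹ ∫_{S_1^+(n)} (ᵞT^{rθ}f)(x) θ^γ dS`. -/
def wMean {n : ℕ} (γ : Fin n → ℝ) (f : (Fin n → ℝ) → ℝ) (x : Fin n → ℝ) (r : ℝ) : ℝ :=
  (wArea n γ)⁻¹ *
    ∫ θ in spherePlus n, gT γ (fun i => r * θ i) f x * ∏ i, θ i ^ γ i ∂(sphereMeasure n)

/-- Partial derivative in the `i`-th coordinate. -/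
def pderiv' {n : ℕ} (i : Fin n) (f : (Fin n → ℝ) → ℝ) (x : Fin n → ℝ) : ℝ :=
  deriv (fun t => f (Function.update x i t)) (x i)

/-- The Laplace–Bessel operator `Δ_γ = Σ_i (∂²/∂x_i² + (γ_i/x_i) ∂/∂x_i)`. -/
def laplaceBessel {n : ℕ} (γ : Fin n → ℝ) (f : (Fin n → ℝ) → ℝ) (x : Fin n → ℝ) : ℝ :=
  ∑ i, (pderiv' i (pderiv' i f) x + γ i / x i * pderiv' i f x)

/-- Euclidean norm on `Fin n → ℝ`. -/
def euclNorm {n : ℕ} (x : Fin n → ℝ) : ℝ := Real.sqrt (∑ i, (x i) ^ 2)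

/-! ### One-dimensional moments -/

lemma gauss_moment_half (q : ℝ) (hq : -1 < q) :
    ∫ x in Ioi (0:ℝ), x ^ q * Real.exp (-x ^ 2) = Real.Gamma ((q + 1) / 2) / 2 := by
  have h := integral_rpow_mul_exp_neg_rpow (p := 2) (q := q) (by norm_num) hq
  have h2 : ∀ x : ℝ, x ^ (2:ℝ) = x ^ (2:ℕ) := fun x => by exact_mod_cast Real.rpow_natCast x 2
  simp only [h2] at h
  rw [h]; ring

lemma gauss_moment_full (l : ℕ) :
    ∫ x : ℝ, x ^ (2 * l) * Real.exp (-x ^ 2) = Real.Gamma ((l : ℝ) + 1 / 2) := by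
  have h := integral_comp_abs (f := fun x : ℝ => x ^ (2 * l) * Real.exp (-x ^ 2))
  have e : ∀ x : ℝ, |x| ^ (2 * l) * Real.exp (-|x| ^ 2) = x ^ (2 * l) * Real.exp (-x ^ 2) := by
    intro x
    rw [pow_mul, pow_mul, sq_abs]
  simp only [e] at h
  rw [h]
  have h3 := gauss_moment_half ((2 * l : ℕ) : ℝ) (by
    have : (0:ℝ) ≤ ((2 * l : ℕ) : ℝ) := Nat.cast_nonneg _
    linarith)
  simp only [Real.rpow_natCast] at h3
  rw [h3]
  have : (((2 * l : ℕ) : ℝ) + 1) / 2 = (l : ℝ) + 1 / 2 := by push_cast; ring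
  rw [this]; ring

lemma cos_moment (ν : ℝ) (hν : 0 < ν) (l : ℕ) :
    ∫ φ in Ioo (0:ℝ) π, Real.cos φ ^ (2 * l) * Real.sin φ ^ (ν - 1)
      = Real.Gamma ((l : ℝ) + 1 / 2) * Real.Gamma (ν / 2) / Real.Gamma ((l : ℝ) + (ν + 1) / 2) := by
  set F : ℝ × ℝ → ℝ := fun p => (p.1 ^ (2 * l) * Real.exp (-p.1 ^ 2)) *
    (Ioi (0:ℝ)).indicator (fun w => w ^ (ν - 1) * Real.exp (-w ^ 2)) p.2 with hF
  have h1 : ∫ p, F p = Real.Gamma ((l : ℝ) + 1 / 2) * (Real.Gamma (ν / 2) / 2) := by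
    rw [hF, Measure.volume_eq_prod, integral_prod_mul (fun x : ℝ => x ^ (2 * l) * Real.exp (-x ^ 2)),
      gauss_moment_full, integral_indicator measurableSet_Ioi, gauss_moment_half _ (by linarith)]
    congr 3; ring
  have h2 := integral_comp_polarCoord_symm F
  rw [h1] at h2
  have h3 : ∫ p in polarCoord.target, p.1 • F (polarCoord.symm p) =
      ∫ p in (Ioi (0:ℝ)) ×ˢ (Ioo (-π) π), (p.1 ^ (2 * (l:ℝ) + ν) * Real.exp (-p.1 ^ 2)) *
        (Ioo (0:ℝ) π).indicator (fun φ => Real.cos φ ^ (2 * l) * Real.sin φ ^ (ν - 1)) p.2 := by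
    refine setIntegral_congr_fun (measurableSet_Ioi.prod measurableSet_Ioo) ?_
    rintro ⟨r, φ⟩ ⟨hr, hφ⟩
    simp only [mem_Ioi] at hr
    simp only [hF, polarCoord, OpenPartialHomeomorph.coe_mk_symm, PartialEquiv.coe_symm_mk, smul_eq_mul]
    by_cases hs : φ ∈ Ioo (0:ℝ) π
    · have hsin : 0 < Real.sin φ := Real.sin_pos_of_mem_Ioo hs
      rw [indicator_of_mem hs, indicator_of_mem (show r * Real.sin φ ∈ Ioi (0:ℝ) from mul_pos hr hsin)]
      rw [Real.mul_rpow hr.le hsin.le, mul_pow]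
      have e1 : Real.exp (-r ^ 2) = Real.exp (-(r * Real.cos φ) ^ 2) * Real.exp (-(r * Real.sin φ) ^ 2) := by
        rw [← Real.exp_add]; congr 1
        have := Real.sin_sq_add_cos_sq φ
        linear_combination (r^2) * this
      have e2 : r ^ (2 * (l:ℝ) + ν) = r * r ^ (2 * l) * r ^ (ν - 1) := by
        rw [← Real.rpow_natCast, ← Real.rpow_one_add' hr.le (by positivity), ← Real.rpow_add hr]
        congr 1; push_cast; ring
      rw [e1, e2]; ring
    · rw [indicator_of_notMem hs, indicator_of_notMem, mul_zero, mul_zero, mul_zero]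
      intro hc
      simp only [mem_Ioi] at hc
      apply hs
      refine ⟨?_, hφ.2⟩
      by_contra hneg
      push Not at hneg
      have := Real.sin_nonpos_of_nonpos_of_neg_pi_le hneg hφ.1.le
      nlinarith
  rw [h3, Measure.volume_eq_prod, setIntegral_prod_mul (fun r : ℝ => r ^ (2 * (l:ℝ) + ν) * Real.exp (-r ^ 2)),
    gauss_moment_half _ (by have : (0:ℝ) ≤ l := Nat.cast_nonneg _
                            linarith), setIntegral_indicator measurableSet_Ioo] at h2
  have h4 : Ioo (-π) π ∩ Ioo 0 π = Ioo 0 π := by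
    apply inter_eq_right.2
    intro x hx
    exact ⟨by linarith [hx.1, Real.pi_pos], hx.2⟩
  rw [h4, show (2 * (l:ℝ) + ν + 1) / 2 = (l:ℝ) + (ν + 1) / 2 by ring] at h2
  have hpos : 0 < Real.Gamma ((l : ℝ) + (ν + 1) / 2) := Real.Gamma_pos_of_pos (by positivity)
  rw [eq_div_iff hpos.ne']
  linear_combination 2 * h2

lemma cos_moment_odd (ν : ℝ) (l : ℕ) :
    ∫ φ in (0:ℝ)..π, Real.cos φ ^ (2 * l + 1) * Real.sin φ ^ (ν - 1) = 0 := by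
  have h := intervalIntegral.integral_comp_sub_left (a := 0) (b := π)
    (fun φ => Real.cos φ ^ (2 * l + 1) * Real.sin φ ^ (ν - 1)) π
  simp only [Real.cos_pi_sub, Real.sin_pi_sub, sub_self, sub_zero] at h
  have e : ∀ φ : ℝ, (-Real.cos φ) ^ (2 * l + 1) * Real.sin φ ^ (ν - 1)
    = -(Real.cos φ ^ (2 * l + 1) * Real.sin φ ^ (ν - 1)) := by
    intro φ; rw [Odd.neg_pow ⟨l, rfl⟩]; ring
  simp only [e, intervalIntegral.integral_neg] at h
  linarith

lemma sin_integrableOn (ν : ℝ) (hν : 0 < ν) :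
    IntegrableOn (fun φ => Real.sin φ ^ (ν - 1)) (Ioo 0 π) := by
  have h := cos_moment ν hν 0
  simp only [mul_zero, pow_zero, one_mul, Nat.cast_zero, zero_add] at h
  by_contra hc
  rw [integral_undef hc] at h
  have h1 : 0 < Real.Gamma (1 / 2) := Real.Gamma_pos_of_pos (by positivity)
  have h2 : 0 < Real.Gamma (ν / 2) := Real.Gamma_pos_of_pos (by positivity)
  have h3 : 0 < Real.Gamma ((ν + 1) / 2) := Real.Gamma_pos_of_pos (by positivity)
  have : 0 < Real.Gamma (1 / 2) * Real.Gamma (ν / 2) / Real.Gamma ((ν + 1) / 2) := by positivity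
  linarith

lemma sin_integrableOn_Icc (ν : ℝ) (hν : 0 < ν) :
    IntegrableOn (fun φ => Real.sin φ ^ (ν - 1)) (Icc 0 π) := by
  rw [integrableOn_Icc_iff_integrableOn_Ioo]
  exact sin_integrableOn ν hν

lemma transC_pos (ν : ℝ) (hν : 0 < ν) : 0 < transC ν := by
  have h2 : 0 < Real.Gamma (ν / 2) := Real.Gamma_pos_of_pos (by positivity)
  have h3 : 0 < Real.Gamma ((ν + 1) / 2) := Real.Gamma_pos_of_pos (by positivity)
  unfold transC; positivity

/-- Taylor coefficients of the normalized Bessel function. -/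
def cc (ν : ℝ) (m : ℕ) : ℝ :=
  Real.Gamma ((ν + 1) / 2) / (4 ^ m * (m.factorial : ℝ) * Real.Gamma ((m : ℝ) + (ν + 1) / 2))

lemma cc_pos (ν : ℝ) (hν : 0 < ν) (m : ℕ) : 0 < cc ν m := by
  have h3 : 0 < Real.Gamma ((ν + 1) / 2) := Real.Gamma_pos_of_pos (by positivity)
  have h2 : 0 < Real.Gamma ((m:ℝ) + (ν + 1) / 2) := Real.Gamma_pos_of_pos (by positivity)
  unfold cc; positivity

lemma gamma_half_nat (l : ℕ) :
    Real.Gamma ((l : ℝ) + 1 / 2) * (4 ^ l * (l.factorial : ℝ)) = ((2 * l).factorial : ℝ) * √π := by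
  induction l with
  | zero => simpa using Real.Gamma_one_half_eq
  | succ l ih =>
    have : ((l + 1 : ℕ) : ℝ) + 1 / 2 = ((l:ℝ) + 1 / 2) + 1 := by push_cast; ring
    rw [this, Real.Gamma_add_one (by positivity), show 2 * (l + 1) = 2 * l + 1 + 1 by ring,
      Nat.factorial_succ, Nat.factorial_succ, Nat.factorial_succ]
    push_cast
    linear_combination ((l:ℝ) + 1/2) * 4 * (l+1) * ih

lemma cos_moment_norm (ν : ℝ) (hν : 0 < ν) (l : ℕ) :
    transC ν * ∫ φ in (0:ℝ)..π, Real.cos φ ^ (2 * l) * Real.sin φ ^ (ν - 1)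
      = ((2 * l).factorial : ℝ) * cc ν l := by
  rw [intervalIntegral.integral_of_le Real.pi_pos.le, integral_Ioc_eq_integral_Ioo, cos_moment ν hν]
  have h := gamma_half_nat l
  have h2 : 0 < Real.Gamma (ν / 2) := Real.Gamma_pos_of_pos (by positivity)
  have h3 : 0 < Real.Gamma ((ν + 1) / 2) := Real.Gamma_pos_of_pos (by positivity)
  have h4 : 0 < Real.Gamma ((l:ℝ) + (ν + 1) / 2) := Real.Gamma_pos_of_pos (by positivity)
  have h5 : 0 < √π := by positivity
  have h6 : (0:ℝ) < l.factorial := by positivity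
  unfold transC cc
  rw [show ((2 * l).factorial : ℝ) = Real.Gamma ((l : ℝ) + 1 / 2) * (4 ^ l * (l.factorial : ℝ)) / √π by
    rw [h]; field_simp]
  field_simp

/-- Chu--Vandermonde. -/
lemma chu (j : ℕ) : ∀ (p : ℕ) (a : ℝ), 0 < a →
    ∑ l ∈ Finset.range (j + 1), (j.choose l : ℝ) * (p.descFactorial l : ℝ) *
      (Real.Gamma (a + j) / Real.Gamma (a + l)) = Real.Gamma (a + p + j) / Real.Gamma (a + p) := by
  induction j with
  | zero => intro p a ha
            have h1 : Real.Gamma a ≠ 0 := (Real.Gamma_pos_of_pos ha).ne'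
            have h2 : Real.Gamma (a + p) ≠ 0 := (Real.Gamma_pos_of_pos (by positivity)).ne'
            simp [h1, h2]
  | succ j ih =>
    intro p a ha
    rw [Finset.sum_range_succ']
    have key : ∀ l : ℕ, ((j + 1).choose (l + 1) : ℝ) = (j.choose l : ℝ) + (j.choose (l + 1) : ℝ) := by
      intro l; rw [Nat.choose_succ_succ]; push_cast; ring
    have e1 : Real.Gamma (a + ((j + 1 : ℕ) : ℝ)) = (a + j) * Real.Gamma (a + j) := by
      rw [← Real.Gamma_add_one (by positivity)]; congr 1; push_cast; ring
    have s1 := ih p a ha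
    rw [Finset.sum_range_succ'] at s1
    have s2 : ∑ l ∈ Finset.range (j + 1), (j.choose l : ℝ) * (p.descFactorial (l + 1) : ℝ) *
        (Real.Gamma (a + ((j + 1 : ℕ) : ℝ)) / Real.Gamma (a + ((l + 1 : ℕ) : ℝ)))
        = p * (Real.Gamma (a + p + j) / Real.Gamma (a + p)) := by
      rcases p with _ | p
      · simp
      · have s := ih p (a + 1) (by linarith)
        have e3 : Real.Gamma (a + 1 + p + j) / Real.Gamma (a + 1 + p)
          = Real.Gamma (a + ((p + 1 : ℕ) : ℝ) + j) / Real.Gamma (a + ((p + 1 : ℕ) : ℝ)) := by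
          push_cast
          rw [show a + 1 + (p:ℝ) + j = a + (p + 1) + j by ring, show a + 1 + (p:ℝ) = a + (p + 1) by ring]
        rw [← e3, ← s, Finset.mul_sum]
        refine Finset.sum_congr rfl fun l _ => ?_
        rw [Nat.succ_descFactorial_succ]
        push_cast
        rw [show a + ((j:ℝ) + 1) = a + 1 + j by ring, show a + ((l:ℝ) + 1) = a + 1 + l by ring]
        ring
    simp only [key, add_mul, Finset.sum_add_distrib]
    rw [s2]
    rw [Finset.sum_range_succ (fun l => (j.choose (l + 1) : ℝ) * _ * _)]
    have s3 : ∑ l ∈ Finset.range j, (j.choose (l + 1) : ℝ) * (p.descFactorial (l + 1) : ℝ) *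
        (Real.Gamma (a + ((j + 1 : ℕ) : ℝ)) / Real.Gamma (a + ((l + 1 : ℕ) : ℝ)))
        = (a + j) * ∑ l ∈ Finset.range j, (j.choose (l + 1) : ℝ) * (p.descFactorial (l + 1) : ℝ) *
        (Real.Gamma (a + j) / Real.Gamma (a + ((l + 1 : ℕ) : ℝ))) := by
      rw [Finset.mul_sum]
      refine Finset.sum_congr rfl fun l _ => ?_
      rw [e1]; ring
    rw [s3]
    have s4 : (∑ l ∈ Finset.range j, (j.choose (l + 1) : ℝ) * (p.descFactorial (l + 1) : ℝ) *
        (Real.Gamma (a + j) / Real.Gamma (a + ((l + 1 : ℕ) : ℝ))))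
        = Real.Gamma (a + p + j) / Real.Gamma (a + p) - Real.Gamma (a + j) / Real.Gamma a := by
      rw [← s1]; simp
    rw [s4]
    have e2 : Real.Gamma (a + p + ((j + 1 : ℕ) : ℝ)) = (a + p + j) * Real.Gamma (a + p + j) := by
      rw [← Real.Gamma_add_one (by positivity)]; congr 1; push_cast; ring
    rw [e2, e1]
    simp only [Nat.choose_succ_self, Nat.cast_zero, Nat.choose_zero_right, Nat.descFactorial_zero, Nat.cast_one, add_zero]
    ring

lemma coef_sum (ν : ℝ) (hν : 0 < ν) (j p m : ℕ) (hm : j + p = m) :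
    cc ν m * (m.factorial : ℝ) * ∑ l ∈ Finset.range (m + 1), (if l ≤ j ∧ l ≤ p then
      4 ^ l * cc ν l / (((j - l).factorial : ℝ) * ((p - l).factorial : ℝ)) else 0)
      = cc ν j * cc ν p := by
  subst hm
  have ha : 0 < (ν + 1) / 2 := by positivity
  have hch := chu j p ((ν + 1) / 2) ha
  set a := (ν + 1) / 2 with hadef
  have hG : ∀ k : ℕ, 0 < Real.Gamma (a + k) := fun k => Real.Gamma_pos_of_pos (by positivity)
  have hGa : 0 < Real.Gamma a := Real.Gamma_pos_of_pos ha
  have hcc : ∀ k : ℕ, cc ν k = Real.Gamma a / (4 ^ k * (k.factorial : ℝ) * Real.Gamma (a + k)) := by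
    intro k; unfold cc; rw [add_comm (k:ℝ)]
  have hs : ∑ l ∈ Finset.range (j + p + 1), (if l ≤ j ∧ l ≤ p then
      4 ^ l * cc ν l / (((j - l).factorial : ℝ) * ((p - l).factorial : ℝ)) else 0)
      = Real.Gamma a / ((j.factorial : ℝ) * (p.factorial : ℝ) * Real.Gamma (a + j)) *
        (Real.Gamma (a + p + j) / Real.Gamma (a + p)) := by
    rw [← hch, Finset.mul_sum]
    have hsub : Finset.range (j + 1) ⊆ Finset.range (j + p + 1) := by
      intro x; simp only [Finset.mem_range]; omega
    rw [← Finset.sum_subset hsub]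
    · refine Finset.sum_congr rfl fun l hl => ?_
      have hl : l ≤ j := by simpa [Nat.lt_succ_iff] using hl
      by_cases hlp : l ≤ p
      · rw [if_pos ⟨hl, hlp⟩, hcc]
        have h1 : (j.choose l : ℝ) * (l.factorial : ℝ) * ((j - l).factorial : ℝ) = j.factorial := by
          exact_mod_cast Nat.choose_mul_factorial_mul_factorial hl
        have h2 : ((p - l).factorial : ℝ) * (p.descFactorial l : ℝ) = p.factorial := by
          exact_mod_cast Nat.factorial_mul_descFactorial hlp
        rw [← h1, ← h2]
        have := (hG l).ne'
        have := (hG j).ne'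
        have h5 : (j.choose l : ℝ) ≠ 0 := by exact_mod_cast (Nat.choose_pos hl).ne'
        have h6 : (p.descFactorial l : ℝ) ≠ 0 := by
          have := Nat.descFactorial_eq_zero_iff_lt (n := p) (k := l)
          exact_mod_cast fun h => absurd (this.1 h) (by omega)
        have h7 : ((p - l).factorial : ℝ) ≠ 0 := by positivity
        have h8 : ((j - l).factorial : ℝ) ≠ 0 := by positivity
        have h9 : (l.factorial : ℝ) ≠ 0 := by positivity
        field_simp
      · rw [if_neg (by tauto), Nat.descFactorial_eq_zero_iff_lt.2 (by omega)]
        simp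
    · intro l _ hl
      rw [if_neg]
      simp only [Finset.mem_range] at hl
      omega
  rw [hs, hcc, hcc, hcc]
  have := (hG j).ne'
  have := (hG p).ne'
  have h3 : Real.Gamma (a + ((j + p : ℕ) : ℝ)) = Real.Gamma (a + p + j) := by
    congr 1; push_cast; ring
  have h4 : Real.Gamma (a + p + j) ≠ 0 := (Real.Gamma_pos_of_pos (by positivity)).ne'
  rw [h3, pow_add]
  have h5 : ((j + p).factorial : ℝ) ≠ 0 := by positivity
  have h6 : (j.factorial : ℝ) ≠ 0 := by positivity
  have h7 : (p.factorial : ℝ) ≠ 0 := by positivity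
  field_simp

lemma double_sum (m : ℕ) (h : ℕ → ℕ → ℕ → ℝ) :
    ∑ l ∈ Finset.range (m + 1), (if 2 * l ≤ m then
      ∑ q ∈ Finset.HasAntidiagonal.antidiagonal (m - 2 * l), h l (q.1 + l) (q.2 + l) else 0)
    = ∑ q ∈ Finset.HasAntidiagonal.antidiagonal m, ∑ l ∈ Finset.range (m + 1),
      (if l ≤ q.1 ∧ l ≤ q.2 then h l q.1 q.2 else 0) := by
  rw [Finset.sum_comm]
  refine Finset.sum_congr rfl fun l _ => ?_
  rw [← Finset.sum_filter]
  split_ifs with hl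
  · refine Finset.sum_nbij' (fun q => (q.1 + l, q.2 + l)) (fun q => (q.1 - l, q.2 - l)) ?_ ?_ ?_ ?_ ?_
    · rintro ⟨a, b⟩ hq
      simp only [Finset.HasAntidiagonal.mem_antidiagonal, Finset.mem_filter] at hq ⊢
      omega
    · rintro ⟨a, b⟩ hq
      simp only [Finset.HasAntidiagonal.mem_antidiagonal, Finset.mem_filter] at hq ⊢
      omega
    · rintro ⟨a, b⟩ hq; simp
    · rintro ⟨a, b⟩ hq
      simp only [Finset.HasAntidiagonal.mem_antidiagonal, Finset.mem_filter] at hq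
      simp only [Prod.mk.injEq]
      omega
    · rintro ⟨a, b⟩ hq; rfl
  · symm
    apply Finset.sum_eq_zero
    rintro ⟨a, b⟩ hq
    simp only [Finset.HasAntidiagonal.mem_antidiagonal, Finset.mem_filter] at hq
    omega

lemma sum_range_two_mul (g : ℕ → ℝ) (N : ℕ) :
    ∑ i ∈ Finset.range (2 * N), g i = ∑ l ∈ Finset.range N, (g (2 * l) + g (2 * l + 1)) := by
  induction N with
  | zero => simp
  | succ N ih =>
    rw [show 2 * (N + 1) = 2 * N + 1 + 1 by ring, Finset.sum_range_succ, Finset.sum_range_succ, ih,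
      Finset.sum_range_succ]
    ring

lemma cos_pow_integrable (ν : ℝ) (hν : 0 < ν) (h : ℝ → ℝ) (hh : Continuous h) :
    IntervalIntegrable (fun φ => h φ * Real.sin φ ^ (ν - 1)) volume 0 π := by
  rw [intervalIntegrable_iff_integrableOn_Icc_of_le Real.pi_pos.le]
  exact (sin_integrableOn_Icc ν hν).continuousOn_mul hh.continuousOn isCompact_Icc

/-- The one-dimensional product formula, coefficientwise. -/
lemma star (ν : ℝ) (hν : 0 < ν) (m : ℕ) (x y : ℝ) :
    cc ν m * (transC ν * ∫ φ in (0:ℝ)..π,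
      (x ^ 2 + y ^ 2 - 2 * x * y * Real.cos φ) ^ m * Real.sin φ ^ (ν - 1))
    = ∑ q ∈ Finset.HasAntidiagonal.antidiagonal m, (cc ν q.1 * (x ^ 2) ^ q.1) * (cc ν q.2 * (y ^ 2) ^ q.2) := by
  have e1 : ∀ φ : ℝ, (x ^ 2 + y ^ 2 - 2 * x * y * Real.cos φ) ^ m * Real.sin φ ^ (ν - 1)
      = ∑ i ∈ Finset.range (2 * (m + 1)), ((-(2 * x * y)) ^ i * (x ^ 2 + y ^ 2) ^ (m - i) * (m.choose i : ℝ)) *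
        (Real.cos φ ^ i * Real.sin φ ^ (ν - 1)) := by
    intro φ
    rw [show x ^ 2 + y ^ 2 - 2 * x * y * Real.cos φ = (-(2 * x * y)) * Real.cos φ + (x ^ 2 + y ^ 2) by ring,
      add_pow, Finset.sum_mul]
    have hsub : Finset.range (m + 1) ⊆ Finset.range (2 * (m + 1)) := by
      intro x; simp only [Finset.mem_range]; omega
    rw [← Finset.sum_subset hsub]
    · refine Finset.sum_congr rfl fun i _ => ?_
      rw [mul_pow]; ring
    · intro i _ hi
      simp only [Finset.mem_range] at hi
      rw [Nat.choose_eq_zero_of_lt (by omega)]; simp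
  simp only [e1]
  rw [intervalIntegral.integral_finsetSum]
  swap
  · intro i _
    exact (cos_pow_integrable ν hν _ (by fun_prop)).const_mul _
  simp only [intervalIntegral.integral_const_mul]
  rw [sum_range_two_mul]
  simp only [cos_moment_odd, mul_zero, add_zero]
  have e2 : transC ν * ∑ l ∈ Finset.range (m + 1), (-(2 * x * y)) ^ (2 * l) * (x ^ 2 + y ^ 2) ^ (m - 2 * l) *
        (m.choose (2 * l) : ℝ) * ∫ φ in (0:ℝ)..π, Real.cos φ ^ (2 * l) * Real.sin φ ^ (ν - 1)
      = ∑ l ∈ Finset.range (m + 1), (if 2 * l ≤ m then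
      ∑ q ∈ Finset.HasAntidiagonal.antidiagonal (m - 2 * l), (fun l j p => (m.factorial : ℝ) * ((x ^ 2) ^ j * (y ^ 2) ^ p *
        (4 ^ l * cc ν l / (((j - l).factorial : ℝ) * ((p - l).factorial : ℝ))))) l (q.1 + l) (q.2 + l) else 0) := by
    rw [Finset.mul_sum]
    refine Finset.sum_congr rfl fun l _ => ?_
    rw [mul_left_comm, cos_moment_norm ν hν]
    split_ifs with hl
    · have h1 : (m.choose (2 * l) : ℝ) * ((2 * l).factorial : ℝ) * ((m - 2 * l).factorial : ℝ) = m.factorial := by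
        exact_mod_cast Nat.choose_mul_factorial_mul_factorial hl
      rw [Commute.add_pow' (Commute.all _ _)]
      rw [Finset.mul_sum, Finset.sum_mul, Finset.sum_mul]
      refine Finset.sum_congr rfl fun q hq => ?_
      obtain ⟨i, k⟩ := q
      have hik : i + k = m - 2 * l := by simpa using hq
      rw [← h1, ← hik]
      have h2 : ((i + k).choose i : ℝ) * (i.factorial : ℝ) * (k.factorial : ℝ) = ((i + k).factorial : ℝ) := by
        have := Nat.choose_mul_factorial_mul_factorial (Nat.le_add_right i k)
        rw [Nat.add_sub_cancel_left] at this
        exact_mod_cast this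
      simp only [Nat.add_sub_cancel, nsmul_eq_mul]
      rw [← h2]
      have h3 : (i.factorial : ℝ) ≠ 0 := by positivity
      have h4 : (k.factorial : ℝ) ≠ 0 := by positivity
      have h5 : (-(2 * x * y)) ^ (2 * l) = 4 ^ l * (x ^ 2) ^ l * (y ^ 2) ^ l := by
        rw [pow_mul, ← mul_pow, ← mul_pow]; congr 1; ring
      rw [h5, pow_add (x ^ 2), pow_add (y ^ 2)]
      field_simp
    · rw [Nat.choose_eq_zero_of_lt (by omega)]; simp
  rw [e2, double_sum m (fun l j p => (m.factorial : ℝ) * ((x ^ 2) ^ j * (y ^ 2) ^ p *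
        (4 ^ l * cc ν l / (((j - l).factorial : ℝ) * ((p - l).factorial : ℝ))))), Finset.mul_sum]
  refine Finset.sum_congr rfl fun q hq => ?_
  have hq' : q.1 + q.2 = m := by simpa using hq
  rw [show cc ν q.1 * (x ^ 2) ^ q.1 * (cc ν q.2 * (y ^ 2) ^ q.2) =
    (x ^ 2) ^ q.1 * (y ^ 2) ^ q.2 * (cc ν q.1 * cc ν q.2) by ring, ← coef_sum ν hν q.1 q.2 m hq']
  rw [Finset.mul_sum, Finset.mul_sum, Finset.mul_sum]
  refine Finset.sum_congr rfl fun l _ => ?_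
  split_ifs
  · ring
  · simp

/-! ### Integration over the sphere -/

lemma measurableSet_spherePlus (n : ℕ) : MeasurableSet (spherePlus n) := by
  have : spherePlus n = ⋂ i, {θ : EuclideanSpace ℝ (Fin n) | 0 < θ i} := by
    ext θ; simp [spherePlus]
  rw [this]
  refine MeasurableSet.iInter fun i => ?_
  exact measurableSet_lt measurable_const (by fun_prop)

lemma polar_gauss (n : ℕ) (hn : 0 < n) (g : EuclideanSpace ℝ (Fin n) → ℝ) (s : ℝ) (hs : 0 ≤ s)
    (hg : ∀ θ ∈ spherePlus n, ∀ r : ℝ, 0 < r → g (r • θ) = r ^ s * g θ) :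
    ∫ x in spherePlus n, g x * Real.exp (-‖x‖ ^ 2) =
      (∫ θ in spherePlus n, g θ ∂(sphereMeasure n)) * (Real.Gamma (((n:ℝ) + s) / 2) / 2) := by
  have hfin : Module.finrank ℝ (EuclideanSpace ℝ (Fin n)) = n := by simp
  have : Nonempty (Fin n) := ⟨⟨0, hn⟩⟩
  have hms := measurableSet_spherePlus n
  set h : EuclideanSpace ℝ (Fin n) → ℝ := (spherePlus n).indicator (fun x => g x * Real.exp (-‖x‖ ^ 2)) with hh
  rw [← integral_indicator hms]
  set F : Metric.sphere (0 : EuclideanSpace ℝ (Fin n)) 1 × Ioi (0:ℝ) → ℝ := fun p =>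
    (spherePlus n).indicator g p.1.1 * (p.2.1 ^ s * Real.exp (-p.2.1 ^ 2)) with hF
  have e1 : ∫ x, h x = ∫ x : ({(0)}ᶜ : Set (EuclideanSpace ℝ (Fin n))), h x.1 ∂(Measure.comap Subtype.val volume) := by
    rw [integral_subtype_comap (measurableSet_singleton _).compl fun x ↦ h x,
        restrict_compl_singleton]
  have e2 : ∫ x : ({(0)}ᶜ : Set (EuclideanSpace ℝ (Fin n))), h x.1 ∂(Measure.comap Subtype.val volume)
      = ∫ p, F p ∂((volume : Measure (EuclideanSpace ℝ (Fin n))).toSphere.prod (.volumeIoiPow (n - 1))) := by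
    have := (volume : Measure (EuclideanSpace ℝ (Fin n))).measurePreserving_homeomorphUnitSphereProd.integral_comp
        (Homeomorph.measurableEmbedding _) F
    rw [hfin] at this
    rw [← this]
    refine integral_congr_ae (Eventually.of_forall ?_)
    rintro ⟨x, hx⟩
    have hx0 : 0 < ‖x‖ := by simpa using hx
    simp only [hF, homeomorphUnitSphereProd_apply_snd_coe, homeomorphUnitSphereProd_apply_fst_coe, hh]
    by_cases hxs : x ∈ spherePlus n
    · have hxs' : ‖x‖⁻¹ • x ∈ spherePlus n := by
        intro i
        simp only [PiLp.smul_apply, smul_eq_mul]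
        exact mul_pos (inv_pos.2 hx0) (hxs i)
      rw [indicator_of_mem hxs, indicator_of_mem hxs']
      have := hg _ hxs' ‖x‖ hx0
      rw [smul_smul, mul_inv_cancel₀ hx0.ne', one_smul] at this
      rw [this]; ring
    · have hxs' : ‖x‖⁻¹ • x ∉ spherePlus n := by
        intro hc
        apply hxs
        intro i
        have := hc i
        simp only [PiLp.smul_apply, smul_eq_mul] at this
        exact (pos_iff_pos_of_mul_pos this).1 (inv_pos.2 hx0)
      rw [indicator_of_notMem hxs, indicator_of_notMem hxs', zero_mul]
  have e3 : ∫ p, F p ∂((volume : Measure (EuclideanSpace ℝ (Fin n))).toSphere.prod (.volumeIoiPow (n - 1)))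
      = (∫ θ, (spherePlus n).indicator g θ.1 ∂((volume : Measure (EuclideanSpace ℝ (Fin n))).toSphere)) *
        ∫ r : Ioi (0:ℝ), (r.1 ^ s * Real.exp (-r.1 ^ 2)) ∂(.volumeIoiPow (n - 1)) :=
    integral_prod_mul (fun θ : Metric.sphere (0 : EuclideanSpace ℝ (Fin n)) 1 => (spherePlus n).indicator g θ.1)
      (fun r : Ioi (0:ℝ) => (r.1 ^ s * Real.exp (-r.1 ^ 2)))
  have e4 : ∫ r : Ioi (0:ℝ), (r.1 ^ s * Real.exp (-r.1 ^ 2)) ∂(.volumeIoiPow (n - 1))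
      = Real.Gamma (((n:ℝ) + s) / 2) / 2 := by
    have hn1 : ((n - 1 : ℕ) : ℝ) = (n:ℝ) - 1 := by rw [Nat.cast_sub (by omega)]; simp
    have hn2 : (1:ℝ) ≤ n := by exact_mod_cast hn
    simp only [Measure.volumeIoiPow, ENNReal.ofReal]
    rw [integral_withDensity_eq_integral_smul,
        integral_subtype_comap measurableSet_Ioi fun a ↦ Real.toNNReal (a ^ (n - 1)) • (a ^ s * Real.exp (-a ^ 2)),
        setIntegral_congr_fun (g := fun a => a ^ ((n:ℝ) - 1 + s) * Real.exp (-a ^ 2)) measurableSet_Ioi fun x hx ↦ ?_]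
    · rw [gauss_moment_half _ (by linarith)]
      congr 3; ring
    · have hx' : 0 < x := hx
      simp only [NNReal.smul_def]
      rw [Real.coe_toNNReal _ (pow_nonneg hx'.le _), Real.rpow_add hx', ← hn1, Real.rpow_natCast, smul_eq_mul]
      ring
    · exact (measurable_subtype_coe.pow_const _).real_toNNReal
  rw [e1, e2, e3, e4]
  congr 1
  rw [← integral_indicator hms, sphereMeasure,
    (MeasurableEmbedding.subtype_coe Metric.isClosed_sphere.measurableSet).integral_map]

/-! ### Test polynomials -/

/-- One-dimensional generating series. -/
def GS (ν η u : ℝ) : PowerSeries ℝ := PowerSeries.mk fun m => cc ν m * η ^ m * (u ^ 2) ^ m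

/-- Test polynomials. -/
def TP {n : ℕ} (γ η : Fin n → ℝ) (N : ℕ) (x : Fin n → ℝ) : ℝ :=
  PowerSeries.coeff N (∏ i, GS (γ i) (η i) (x i))

lemma TP_eq {n : ℕ} (γ η : Fin n → ℝ) (N : ℕ) (x : Fin n → ℝ) :
    TP γ η N x = ∑ m ∈ (Finset.univ : Finset (Fin n)).finsuppAntidiag N,
      ∏ i, (cc (γ i) (m i) * η i ^ m i * (x i ^ 2) ^ m i) := by
  simp [TP, PowerSeries.coeff_prod, GS]

lemma TP_zero {n : ℕ} (γ η : Fin n → ℝ) (hγ : ∀ i, 0 < γ i) (x : Fin n → ℝ) : TP γ η 0 x = 1 := by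
  have : ∀ i, cc (γ i) 0 = 1 := by
    intro i
    have h3 : 0 < Real.Gamma ((γ i + 1) / 2) :=
      Real.Gamma_pos_of_pos (by have := hγ i; positivity)
    simp [cc, h3.ne']
  rw [TP_eq]
  simp [this]

lemma TP_smul {n : ℕ} (γ η : Fin n → ℝ) (N : ℕ) (x : Fin n → ℝ) (t : ℝ) :
    TP γ η N (fun i => t * x i) = (t ^ 2) ^ N * TP γ η N x := by
  rw [TP_eq, TP_eq, Finset.mul_sum]
  refine Finset.sum_congr rfl fun m hm => ?_
  have : ∑ i, m i = N := (Finset.mem_finsuppAntidiag.1 hm).1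
  rw [← this, ← Finset.prod_pow_eq_pow_sum, ← Finset.prod_mul_distrib]
  refine Finset.prod_congr rfl fun i _ => ?_
  rw [mul_pow, mul_pow]; ring

lemma continuous_TP {n : ℕ} (γ η : Fin n → ℝ) (N : ℕ) : Continuous (TP γ η N) := by
  have : TP γ η N = fun x => ∑ m ∈ (Finset.univ : Finset (Fin n)).finsuppAntidiag N,
      ∏ i, (cc (γ i) (m i) * η i ^ m i * (x i ^ 2) ^ m i) := by
    ext x; rw [TP_eq]
  rw [this]; fun_prop

lemma arg_nonneg (x y φ : ℝ) : 0 ≤ x ^ 2 + y ^ 2 - 2 * x * y * Real.cos φ := by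
  have h1 := Real.sin_sq_add_cos_sq φ
  nlinarith [sq_nonneg (x - y * Real.cos φ), sq_nonneg (y * Real.sin φ)]

lemma restrict_box (n : ℕ) : (volume : Measure (Fin n → ℝ)).restrict
    (Set.pi Set.univ (fun _ : Fin n => Set.Icc (0 : ℝ) π)) =
    Measure.pi (fun _ : Fin n => (volume : Measure ℝ).restrict (Set.Icc (0 : ℝ) π)) := by
  rw [volume_pi, Measure.restrict_pi_pi]

/-- Integrand factor. -/
def fac {n : ℕ} (γ η : Fin n → ℝ) (m : Fin n →₀ ℕ) (x y : Fin n → ℝ) (i : Fin n) (φ : ℝ) : ℝ :=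
  (cc (γ i) (m i) * η i ^ m i) *
    (((x i) ^ 2 + (y i) ^ 2 - 2 * x i * y i * Real.cos φ) ^ m i * Real.sin φ ^ (γ i - 1))

lemma gT_TP {n : ℕ} (γ η : Fin n → ℝ) (hγ : ∀ i, 0 < γ i) (N : ℕ) (x y : Fin n → ℝ) :
    gT γ y (TP γ η N) x = ∑ q ∈ Finset.HasAntidiagonal.antidiagonal N, TP γ η q.1 x * TP γ η q.2 y := by
  have e1 : ∀ φ : Fin n → ℝ,
      TP γ η N (fun i => Real.sqrt ((x i) ^ 2 + (y i) ^ 2 - 2 * x i * y i * Real.cos (φ i))) *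
        ∏ i, Real.sin (φ i) ^ (γ i - 1)
      = ∑ m ∈ (Finset.univ : Finset (Fin n)).finsuppAntidiag N,
        ∏ i, fac γ η m x y i (φ i) := by
    intro φ
    rw [TP_eq, Finset.sum_mul]
    refine Finset.sum_congr rfl fun m _ => ?_
    rw [← Finset.prod_mul_distrib]
    refine Finset.prod_congr rfl fun i _ => ?_
    rw [Real.sq_sqrt (arg_nonneg _ _ _), fac]
    ring
  unfold gT
  simp only [e1]
  rw [restrict_box, integral_finsetSum]
  swap
  · intro m _
    refine Integrable.fintype_prod (f := fac γ η m x y) fun i => ?_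
    unfold fac
    refine Integrable.const_mul ?_ _
    refine (sin_integrableOn_Icc (γ i) (hγ i)).continuousOn_mul ?_ isCompact_Icc
    fun_prop
  have e2 : ∀ m : Fin n →₀ ℕ, (∏ i, transC (γ i)) * ∫ φ : Fin n → ℝ,
      ∏ i, fac γ η m x y i (φ i)
        ∂(Measure.pi (fun _ : Fin n => (volume : Measure ℝ).restrict (Set.Icc (0 : ℝ) π)))
      = ∏ i, PowerSeries.coeff (m i) (GS (γ i) (η i) (x i) * GS (γ i) (η i) (y i)) := by
    intro m
    rw [integral_fintype_prod_eq_prod (fac γ η m x y), ← Finset.prod_mul_distrib]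
    refine Finset.prod_congr rfl fun i _ => ?_
    unfold fac
    rw [integral_const_mul, integral_Icc_eq_integral_Ioc, ← intervalIntegral.integral_of_le Real.pi_pos.le]
    have := star (γ i) (hγ i) (m i) (x i) (y i)
    rw [PowerSeries.coeff_mul]
    have e3 : ∑ q ∈ Finset.HasAntidiagonal.antidiagonal (m i),
        (PowerSeries.coeff q.1) (GS (γ i) (η i) (x i)) * (PowerSeries.coeff q.2) (GS (γ i) (η i) (y i))
        = η i ^ m i * ∑ q ∈ Finset.HasAntidiagonal.antidiagonal (m i),
          (cc (γ i) q.1 * (x i ^ 2) ^ q.1) * (cc (γ i) q.2 * (y i ^ 2) ^ q.2) := by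
      rw [Finset.mul_sum]
      refine Finset.sum_congr rfl fun q hq => ?_
      rw [← Finset.HasAntidiagonal.mem_antidiagonal.1 hq, pow_add]
      simp only [GS, PowerSeries.coeff_mk]
      ring
    rw [e3, ← this]
    ring
  rw [Finset.mul_sum, Finset.sum_congr rfl fun m _ => e2 m, ← PowerSeries.coeff_prod,
    Finset.prod_mul_distrib, PowerSeries.coeff_mul]
  rfl

lemma gauss_half_integrable (q : ℝ) (hq : -1 < q) :
    IntegrableOn (fun x => x ^ q * Real.exp (-x ^ 2)) (Ioi (0:ℝ)) := by
  by_contra hc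
  have h := gauss_moment_half q hq
  rw [integral_undef hc] at h
  have : 0 < Real.Gamma ((q + 1) / 2) := Real.Gamma_pos_of_pos (by linarith)
  linarith

/-- Gaussian integrand factor. -/
def gfac {n : ℕ} (γ η : Fin n → ℝ) (m : Fin n →₀ ℕ) (i : Fin n) (u : ℝ) : ℝ :=
  (cc (γ i) (m i) * η i ^ m i) * (u ^ (2 * (m i : ℝ) + γ i) * Real.exp (-u ^ 2))

lemma integral_spherePlus_eq (n : ℕ) (g : (Fin n → ℝ) → ℝ) :
    ∫ x in spherePlus n, g x.ofLp = ∫ x : Fin n → ℝ, g x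
      ∂(Measure.pi (fun _ : Fin n => (volume : Measure ℝ).restrict (Ioi (0:ℝ)))) := by
  rw [← Measure.restrict_pi_pi, ← volume_pi]
  have := (EuclideanSpace.volume_preserving_symm_measurableEquiv_toLp (Fin n)).setIntegral_preimage_emb
    (MeasurableEquiv.measurableEmbedding _) g (Set.pi Set.univ fun _ => Ioi (0:ℝ))
  rw [← this]
  have e : spherePlus n = (MeasurableEquiv.toLp 2 (Fin n → ℝ)).symm ⁻¹' (Set.pi Set.univ fun _ => Ioi (0:ℝ)) := by
    ext x
    simp [spherePlus]
  rw [e]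
  rfl

lemma gauss_TP {n : ℕ} (γ η : Fin n → ℝ) (hγ : ∀ i, 0 < γ i) (N : ℕ) :
    ∫ x in spherePlus n, (TP γ η N x.ofLp * ∏ i, x i ^ γ i) * Real.exp (-‖x‖ ^ 2)
      = (∏ i, Real.Gamma ((γ i + 1) / 2) / 2) * (((∑ i, η i) / 4) ^ N / (N.factorial : ℝ)) := by
  have e0 : ∀ x : EuclideanSpace ℝ (Fin n), (TP γ η N x.ofLp * ∏ i, x i ^ γ i) * Real.exp (-‖x‖ ^ 2)
      = (fun y : Fin n → ℝ => (TP γ η N y * ∏ i, y i ^ γ i) * Real.exp (-∑ i, y i ^ 2)) x.ofLp := by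
    intro x
    simp only [EuclideanSpace.real_norm_sq_eq]
  simp only [e0]
  rw [integral_spherePlus_eq n (fun y : Fin n → ℝ => (TP γ η N y * ∏ i, y i ^ γ i) * Real.exp (-∑ i, y i ^ 2))]
  have e1 : ∀ᵐ y : Fin n → ℝ ∂(Measure.pi (fun _ : Fin n => (volume : Measure ℝ).restrict (Ioi (0:ℝ)))),
      (TP γ η N y * ∏ i, y i ^ γ i) * Real.exp (-∑ i, y i ^ 2)
      = ∑ m ∈ (Finset.univ : Finset (Fin n)).finsuppAntidiag N, ∏ i, gfac γ η m i (y i) := by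
    rw [← Measure.restrict_pi_pi]
    filter_upwards [ae_restrict_mem (MeasurableSet.univ_pi fun _ => measurableSet_Ioi)] with y hy
    rw [TP_eq, Finset.sum_mul, Finset.sum_mul]
    refine Finset.sum_congr rfl fun m _ => ?_
    rw [← Finset.sum_neg_distrib, Real.exp_sum, ← Finset.prod_mul_distrib, ← Finset.prod_mul_distrib]
    refine Finset.prod_congr rfl fun i _ => ?_
    have hyi : 0 < y i := hy i (mem_univ _)
    have e : (y i ^ 2) ^ m i = y i ^ (2 * (m i:ℝ)) := by
      rw [← pow_mul, ← Real.rpow_natCast]; push_cast; rfl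
    rw [gfac, Real.rpow_add hyi, e]
    ring
  rw [integral_congr_ae e1, integral_finsetSum]
  swap
  · intro m _
    refine Integrable.fintype_prod (f := gfac γ η m) fun i => ?_
    unfold gfac
    refine Integrable.const_mul ?_ _
    exact gauss_half_integrable _ (by have := hγ i; have : (0:ℝ) ≤ m i := Nat.cast_nonneg _; linarith)
  have e2 : ∀ m ∈ (Finset.univ : Finset (Fin n)).finsuppAntidiag N, ∫ y : Fin n → ℝ, ∏ i, gfac γ η m i (y i)
      ∂(Measure.pi (fun _ : Fin n => (volume : Measure ℝ).restrict (Ioi (0:ℝ))))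
      = (∏ i, Real.Gamma ((γ i + 1) / 2) / 2) *
        ∏ i, PowerSeries.coeff (m i) (PowerSeries.rescale (η i / 4) (PowerSeries.exp ℝ)) := by
    intro m _
    rw [integral_fintype_prod_eq_prod (gfac γ η m), ← Finset.prod_mul_distrib]
    refine Finset.prod_congr rfl fun i _ => ?_
    have hi := hγ i
    have hm : (0:ℝ) ≤ m i := Nat.cast_nonneg _
    unfold gfac
    rw [integral_const_mul, gauss_moment_half _ (by linarith), PowerSeries.coeff_rescale, PowerSeries.coeff_exp, cc]
    rw [show (2 * (m i : ℝ) + γ i + 1) / 2 = (m i : ℝ) + (γ i + 1) / 2 by ring]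
    have h2 : Real.Gamma ((m i : ℝ) + (γ i + 1) / 2) ≠ 0 := (Real.Gamma_pos_of_pos (by positivity)).ne'
    have h3 : ((m i).factorial : ℝ) ≠ 0 := by positivity
    simp only [one_div, map_inv₀, map_natCast, div_pow]
    field_simp
  rw [Finset.sum_congr rfl e2, ← Finset.mul_sum, ← PowerSeries.coeff_prod]
  congr 1
  have e3 : ∀ s : Finset (Fin n), ∏ i ∈ s, PowerSeries.rescale (η i / 4) (PowerSeries.exp ℝ)
      = PowerSeries.rescale (∑ i ∈ s, η i / 4) (PowerSeries.exp ℝ) := by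
    intro s
    induction s using Finset.induction_on with
    | empty => simp
    | insert a s ha ih => rw [Finset.prod_insert ha, Finset.sum_insert ha, ih, PowerSeries.exp_mul_exp_eq_exp_add]
  rw [e3, PowerSeries.coeff_rescale, PowerSeries.coeff_exp, Finset.sum_div]
  simp [div_eq_mul_inv]

lemma sphere_integrable (n : ℕ) (h : EuclideanSpace ℝ (Fin n) → ℝ) (hh : Continuous h) :
    Integrable h (sphereMeasure n) := by
  rw [sphereMeasure, (MeasurableEmbedding.subtype_coe Metric.isClosed_sphere.measurableSet).integrable_map_iff]
  exact (hh.comp continuous_subtype_val).integrable_of_hasCompactSupport (HasCompactSupport.of_compactSpace _)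

lemma continuous_weight {n : ℕ} (γ : Fin n → ℝ) (hγ : ∀ i, 0 < γ i) :
    Continuous (fun θ : EuclideanSpace ℝ (Fin n) => ∏ i, θ i ^ γ i) := by
  refine continuous_finsetProd _ fun i _ => ?_
  exact (Real.continuous_rpow_const (hγ i).le).comp (by fun_prop)

lemma sphere_TP {n : ℕ} (hn : 0 < n) (γ η : Fin n → ℝ) (hγ : ∀ i, 0 < γ i) (N : ℕ) :
    (∫ θ in spherePlus n, TP γ η N θ.ofLp * ∏ i, θ i ^ γ i ∂(sphereMeasure n)) *
      (Real.Gamma ((N : ℝ) + ((n : ℝ) + ∑ i, γ i) / 2) / 2)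
    = (∏ i, Real.Gamma ((γ i + 1) / 2) / 2) * (((∑ i, η i) / 4) ^ N / (N.factorial : ℝ)) := by
  rw [← gauss_TP γ η hγ N, polar_gauss n hn _ (2 * (N:ℝ) + ∑ i, γ i)]
  · congr 3; ring
  · have : 0 ≤ ∑ i, γ i := Finset.sum_nonneg fun i _ => (hγ i).le
    positivity
  · intro θ hθ r hr
    have h1 : (r • θ).ofLp = fun i => r * θ i := by ext i; simp
    have h2 : ∀ i, (r • θ) i = r * θ i := fun i => by simp
    simp only [h2]
    rw [h1, TP_smul, Real.rpow_add hr, Real.rpow_sum_of_pos hr]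
    rw [Finset.prod_congr rfl fun i _ => Real.mul_rpow hr.le (hθ i).le, Finset.prod_mul_distrib,
      ← pow_mul, ← Real.rpow_natCast]
    push_cast
    ring

lemma wArea_eq {n : ℕ} (hn : 0 < n) (γ : Fin n → ℝ) (hγ : ∀ i, 0 < γ i) :
    wArea n γ * (Real.Gamma (((n : ℝ) + ∑ i, γ i) / 2) / 2) = ∏ i, Real.Gamma ((γ i + 1) / 2) / 2 := by
  have := sphere_TP hn γ 0 hγ 0
  simp only [TP_zero γ 0 hγ, one_mul] at this
  simpa [wArea] using this

lemma k_pos {n : ℕ} (hn : 0 < n) (γ : Fin n → ℝ) (hγ : ∀ i, 0 < γ i) :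
    0 < (n : ℝ) + ∑ i, γ i - 1 := by
  have : Nonempty (Fin n) := ⟨⟨0, hn⟩⟩
  have : 0 < ∑ i, γ i := Finset.sum_pos (fun i _ => hγ i) Finset.univ_nonempty
  have : (1:ℝ) ≤ n := by exact_mod_cast hn
  linarith

lemma wArea_pos {n : ℕ} (hn : 0 < n) (γ : Fin n → ℝ) (hγ : ∀ i, 0 < γ i) : 0 < wArea n γ := by
  have h := wArea_eq hn γ hγ
  have h1 : 0 < Real.Gamma (((n : ℝ) + ∑ i, γ i) / 2) :=
    Real.Gamma_pos_of_pos (by have := k_pos hn γ hγ; linarith)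
  have h2 : 0 < ∏ i, Real.Gamma ((γ i + 1) / 2) / 2 :=
    Finset.prod_pos fun i _ => by
      have : 0 < Real.Gamma ((γ i + 1) / 2) := Real.Gamma_pos_of_pos (by have := hγ i; linarith)
      positivity
  rw [← h] at h2
  exact (pos_iff_pos_of_mul_pos h2).2 (by positivity)

lemma sphere_mean_TP {n : ℕ} (hn : 0 < n) (γ η : Fin n → ℝ) (hγ : ∀ i, 0 < γ i) (N : ℕ) :
    (wArea n γ)⁻¹ * ∫ θ in spherePlus n, TP γ η N θ.ofLp * ∏ i, θ i ^ γ i ∂(sphereMeasure n)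
    = cc ((n : ℝ) + ∑ i, γ i - 1) N * (∑ i, η i) ^ N := by
  have hk := k_pos hn γ hγ
  have h1 := sphere_TP hn γ η hγ N
  have h2 := wArea_eq hn γ hγ
  have h3 := wArea_pos hn γ hγ
  rw [← h2] at h1
  have h4 : 0 < Real.Gamma ((N : ℝ) + ((n : ℝ) + ∑ i, γ i) / 2) :=
    Real.Gamma_pos_of_pos (by have : (0:ℝ) ≤ N := Nat.cast_nonneg _; linarith)
  rw [cc, show (n : ℝ) + ∑ i, γ i - 1 + 1 = (n : ℝ) + ∑ i, γ i by ring]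
  rw [inv_mul_eq_iff_eq_mul₀ h3.ne']
  rw [div_pow] at h1
  have h5 : (N.factorial : ℝ) ≠ 0 := by positivity
  generalize Real.Gamma ((N : ℝ) + ((n : ℝ) + ∑ i, γ i) / 2) = G at *
  generalize Real.Gamma (((n : ℝ) + ∑ i, γ i) / 2) = G' at *
  have h6 : (4:ℝ) ^ N ≠ 0 := by positivity
  have h7 := h4.ne'
  generalize (∫ θ in spherePlus n, TP γ η N θ.ofLp * ∏ i, θ i ^ γ i ∂(sphereMeasure n)) = I at *
  generalize (4:ℝ) ^ N = F at *
  field_simp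
  field_simp at h1
  linear_combination h1

lemma wMean_TP {n : ℕ} (hn : 0 < n) (γ η : Fin n → ℝ) (hγ : ∀ i, 0 < γ i) (N : ℕ) (x : Fin n → ℝ) (r : ℝ) :
    wMean γ (TP γ η N) x r = ∑ q ∈ Finset.HasAntidiagonal.antidiagonal N,
      TP γ η q.1 x * (cc ((n : ℝ) + ∑ i, γ i - 1) q.2 * (∑ i, η i) ^ q.2 * (r ^ 2) ^ q.2) := by
  unfold wMean
  simp only [gT_TP γ η hγ, TP_smul, Finset.sum_mul]
  rw [integral_finsetSum]
  · rw [Finset.mul_sum]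
    refine Finset.sum_congr rfl fun q _ => ?_
    rw [← sphere_mean_TP hn γ η hγ q.2]
    have : ∀ θ : EuclideanSpace ℝ (Fin n), TP γ η q.1 x * ((r ^ 2) ^ q.2 * TP γ η q.2 θ.ofLp) * ∏ i, θ i ^ γ i
      = (TP γ η q.1 x * (r ^ 2) ^ q.2) * (TP γ η q.2 θ.ofLp * ∏ i, θ i ^ γ i) := fun θ => by ring
    simp only [this]
    rw [integral_const_mul]
    ring
  · intro q _
    refine (sphere_integrable n _ ?_).integrableOn
    have h1 := continuous_weight γ hγ
    have h2 := (continuous_TP γ η q.2).comp (PiLp.continuous_ofLp 2 (fun _ : Fin n => ℝ))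
    exact (continuous_const.mul (continuous_const.mul h2)).mul h1

/-- The cube of angles. -/
def box (n : ℕ) : Set (Fin n → ℝ) := Set.pi Set.univ (fun _ : Fin n => Set.Icc (0 : ℝ) π)

/-- The normalized angular weight. -/
def kw {n : ℕ} (γ : Fin n → ℝ) (φ : Fin n → ℝ) : ℝ := ∏ i, (transC (γ i) * Real.sin (φ i) ^ (γ i - 1))

/-- The angular probability measure. -/
def KM {n : ℕ} (γ : Fin n → ℝ) : Measure (Fin n → ℝ) :=
  ((volume : Measure (Fin n → ℝ)).restrict (box n)).withDensity fun φ => ENNReal.ofReal (kw γ φ)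

/-- The shifted point. -/
def SP {n : ℕ} (x y φ : Fin n → ℝ) : Fin n → ℝ :=
  fun i => Real.sqrt ((x i) ^ 2 + (y i) ^ 2 - 2 * x i * y i * Real.cos (φ i))

lemma isCompact_box (n : ℕ) : IsCompact (box n) := isCompact_univ_pi fun _ => isCompact_Icc

lemma kw_nonneg {n : ℕ} (γ : Fin n → ℝ) (hγ : ∀ i, 0 < γ i) (φ : Fin n → ℝ) (h : φ ∈ box n) : 0 ≤ kw γ φ := by
  refine Finset.prod_nonneg fun i _ => ?_
  have h1 := h i (mem_univ _)
  exact mul_nonneg (transC_pos _ (hγ i)).le (Real.rpow_nonneg (Real.sin_nonneg_of_nonneg_of_le_pi h1.1 h1.2) _)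

lemma kw_measurable {n : ℕ} (γ : Fin n → ℝ) : Measurable (kw γ) := by
  unfold kw
  fun_prop

lemma gT_eq {n : ℕ} (γ : Fin n → ℝ) (hγ : ∀ i, 0 < γ i) (y : Fin n → ℝ) (f : (Fin n → ℝ) → ℝ) (x : Fin n → ℝ) :
    gT γ y f x = ∫ φ, f (SP x y φ) ∂(KM γ) := by
  unfold KM
  rw [integral_withDensity_eq_integral_toReal_smul (by exact (kw_measurable γ).ennreal_ofReal) (by simp)]
  unfold gT
  rw [← integral_const_mul]
  refine setIntegral_congr_fun (isCompact_box n).measurableSet fun φ hφ => ?_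
  have e := ENNReal.toReal_ofReal (kw_nonneg γ hγ φ hφ)
  change _ = (ENNReal.ofReal (kw γ φ)).toReal * f (SP x y φ)
  rw [e]
  simp only [kw, Finset.prod_mul_distrib]
  rw [show SP x y φ = fun i => Real.sqrt ((x i) ^ 2 + (y i) ^ 2 - 2 * x i * y i * Real.cos (φ i)) from rfl]
  ring

lemma KM_prob {n : ℕ} (γ : Fin n → ℝ) (hγ : ∀ i, 0 < γ i) : IsProbabilityMeasure (KM γ) := by
  have h := gT_TP γ 0 hγ 0 0 0
  rw [gT_eq γ hγ] at h
  simp [TP_zero γ 0 hγ] at h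
  constructor
  have : (KM γ univ).toReal = 1 := h
  rwa [ENNReal.toReal_eq_one_iff] at this

lemma KM_restrict {n : ℕ} (γ : Fin n → ℝ) : (KM γ).restrict (box n) = KM γ := by
  unfold KM
  rw [restrict_withDensity (isCompact_box n).measurableSet, Measure.restrict_restrict (isCompact_box n).measurableSet, inter_self]

/-- The spherical probability measure. -/
def SM {n : ℕ} (γ : Fin n → ℝ) : Measure (EuclideanSpace ℝ (Fin n)) :=
  ((sphereMeasure n).restrict (spherePlus n)).withDensity
    fun θ => ENNReal.ofReal ((wArea n γ)⁻¹ * ∏ i, θ i ^ γ i)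

lemma int_SM {n : ℕ} (hn : 0 < n) (γ : Fin n → ℝ) (hγ : ∀ i, 0 < γ i) (g : EuclideanSpace ℝ (Fin n) → ℝ) :
    ∫ θ, g θ ∂(SM γ) = (wArea n γ)⁻¹ * ∫ θ in spherePlus n, g θ * ∏ i, θ i ^ γ i ∂(sphereMeasure n) := by
  unfold SM
  rw [integral_withDensity_eq_integral_toReal_smul
    (by exact ((continuous_weight γ hγ).measurable.const_mul _).ennreal_ofReal) (by simp)]
  rw [← integral_const_mul]
  refine setIntegral_congr_fun (measurableSet_spherePlus n) fun θ hθ => ?_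
  have h0 : 0 ≤ (wArea n γ)⁻¹ * ∏ i, θ i ^ γ i :=
    mul_nonneg (inv_nonneg.2 (wArea_pos hn γ hγ).le) (Finset.prod_nonneg fun i _ => Real.rpow_nonneg (hθ i).le _)
  simp only [ENNReal.toReal_ofReal h0, smul_eq_mul]
  ring

lemma SM_prob {n : ℕ} (hn : 0 < n) (γ : Fin n → ℝ) (hγ : ∀ i, 0 < γ i) : IsProbabilityMeasure (SM γ) := by
  have h := int_SM hn γ hγ (fun _ => 1)
  simp only [one_mul] at h
  rw [show ∫ θ in spherePlus n, ∏ i, θ i ^ γ i ∂(sphereMeasure n) = wArea n γ from rfl,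
    inv_mul_cancel₀ (wArea_pos hn γ hγ).ne'] at h
  constructor
  simp at h
  have : (SM γ univ).toReal = 1 := h
  rwa [ENNReal.toReal_eq_one_iff] at this

lemma SM_restrict {n : ℕ} (γ : Fin n → ℝ) : (SM γ).restrict (Metric.sphere 0 1) = SM γ := by
  have hm : MeasurableSet (Metric.sphere (0 : EuclideanSpace ℝ (Fin n)) 1) := Metric.isClosed_sphere.measurableSet
  rw [Measure.restrict_eq_self_of_ae_mem]
  unfold SM
  refine (withDensity_absolutelyContinuous _ _).ae_le ?_
  refine ae_restrict_of_ae ?_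
  unfold sphereMeasure
  exact (ae_map_iff (p := fun x => x ∈ Metric.sphere (0 : EuclideanSpace ℝ (Fin n)) 1)
    measurable_subtype_coe.aemeasurable hm).2 (Eventually.of_forall fun θ => θ.2)

lemma wMean_eq {n : ℕ} (hn : 0 < n) (γ : Fin n → ℝ) (hγ : ∀ i, 0 < γ i) (f : (Fin n → ℝ) → ℝ) (x : Fin n → ℝ) (r : ℝ) :
    wMean γ f x r = ∫ θ, (∫ φ, f (SP x (fun i => r * θ i) φ) ∂(KM γ)) ∂(SM γ) := by
  rw [int_SM hn γ hγ, wMean]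
  simp only [gT_eq γ hγ]

lemma continuous_SP {n : ℕ} : Continuous (fun p : ((Fin n → ℝ) × (Fin n → ℝ)) × (Fin n → ℝ) => SP p.1.1 p.1.2 p.2) := by
  unfold SP
  fun_prop

lemma continuous_gT {n : ℕ} (γ : Fin n → ℝ) (hγ : ∀ i, 0 < γ i) (f : (Fin n → ℝ) → ℝ) (hf : Continuous f) :
    Continuous (fun p : (Fin n → ℝ) × (Fin n → ℝ) => ∫ φ, f (SP p.1 p.2 φ) ∂(KM γ)) := by
  have := KM_prob γ hγ
  rw [← KM_restrict γ]
  exact continuous_parametric_integral_of_continuous (f := fun (p : (Fin n → ℝ) × (Fin n → ℝ)) φ => f (SP p.1 p.2 φ)) 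
    (hf.comp continuous_SP) (isCompact_box n)

lemma continuous_wMean {n : ℕ} (hn : 0 < n) (γ : Fin n → ℝ) (hγ : ∀ i, 0 < γ i) (f : (Fin n → ℝ) → ℝ) (hf : Continuous f) :
    Continuous (fun p : (Fin n → ℝ) × ℝ => wMean γ f p.1 p.2) := by
  have := SM_prob hn γ hγ
  simp only [wMean_eq hn γ hγ]
  rw [← SM_restrict γ]
  refine continuous_parametric_integral_of_continuous
    (f := fun (p : (Fin n → ℝ) × ℝ) (θ : EuclideanSpace ℝ (Fin n)) => ∫ φ, f (SP p.1 (fun i => p.2 * θ i) φ) ∂(KM γ)) ?_ (isCompact_sphere _ _)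
  have h := continuous_gT γ hγ f hf
  exact h.comp (g := fun p : (Fin n → ℝ) × (Fin n → ℝ) => ∫ φ, f (SP p.1 p.2 φ) ∂(KM γ))
    (f := fun q : ((Fin n → ℝ) × ℝ) × EuclideanSpace ℝ (Fin n) => (q.1.1, fun i => q.1.2 * q.2 i)) (by fun_prop)

lemma integrable_KM {n : ℕ} (γ : Fin n → ℝ) (hγ : ∀ i, 0 < γ i) (g : (Fin n → ℝ) → ℝ) (hg : Continuous g) :
    Integrable g (KM γ) := by
  have := KM_prob γ hγ
  rw [← KM_restrict γ]
  exact hg.continuousOn.integrableOn_compact (isCompact_box n)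

lemma integrable_SM {n : ℕ} (hn : 0 < n) (γ : Fin n → ℝ) (hγ : ∀ i, 0 < γ i) (g : EuclideanSpace ℝ (Fin n) → ℝ) (hg : Continuous g) :
    Integrable g (SM γ) := by
  have := SM_prob hn γ hγ
  rw [← SM_restrict γ]
  exact hg.continuousOn.integrableOn_compact (isCompact_sphere _ _)

lemma continuous_in {n : ℕ} (γ : Fin n → ℝ) (hγ : ∀ i, 0 < γ i) (f : (Fin n → ℝ) → ℝ) (hf : Continuous f) (x : Fin n → ℝ) (r : ℝ) :
    Continuous (fun θ : EuclideanSpace ℝ (Fin n) => ∫ φ, f (SP x (fun i => r * θ i) φ) ∂(KM γ)) := by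
  have h := continuous_gT γ hγ f hf
  exact h.comp (g := fun p : (Fin n → ℝ) × (Fin n → ℝ) => ∫ φ, f (SP p.1 p.2 φ) ∂(KM γ))
    (f := fun q : EuclideanSpace ℝ (Fin n) => (x, fun i => r * q i)) (by fun_prop)

lemma continuous_in2 {n : ℕ} (f : (Fin n → ℝ) → ℝ) (hf : Continuous f) (x y : Fin n → ℝ) :
    Continuous (fun φ => f (SP x y φ)) := by
  refine hf.comp ?_
  unfold SP
  fun_prop

lemma wMean_add {n : ℕ} (hn : 0 < n) (γ : Fin n → ℝ) (hγ : ∀ i, 0 < γ i) (f g : (Fin n → ℝ) → ℝ)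
    (hf : Continuous f) (hg : Continuous g) (x : Fin n → ℝ) (r : ℝ) :
    wMean γ (fun y => f y + g y) x r = wMean γ f x r + wMean γ g x r := by
  simp only [wMean_eq hn γ hγ]
  rw [← integral_add (integrable_SM hn γ hγ _ (continuous_in γ hγ f hf x r)) (integrable_SM hn γ hγ _ (continuous_in γ hγ g hg x r))]
  congr 1; ext θ
  rw [← integral_add (integrable_KM γ hγ _ (continuous_in2 f hf x _)) (integrable_KM γ hγ _ (continuous_in2 g hg x _))]

lemma wMean_const_mul {n : ℕ} (hn : 0 < n) (γ : Fin n → ℝ) (hγ : ∀ i, 0 < γ i) (f : (Fin n → ℝ) → ℝ)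
    (c : ℝ) (x : Fin n → ℝ) (r : ℝ) :
    wMean γ (fun y => c * f y) x r = c * wMean γ f x r := by
  simp only [wMean_eq hn γ hγ, integral_const_mul]

lemma SP_bound {n : ℕ} (x y φ : Fin n → ℝ) (i : Fin n) : SP x y φ i ≤ |x i| + |y i| := by
  unfold SP
  rw [Real.sqrt_le_left (by positivity)]
  have h := Real.abs_cos_le_one (φ i)
  have h1 : |x i * y i * Real.cos (φ i)| ≤ |x i| * |y i| := by
    rw [abs_mul, abs_mul]
    exact mul_le_of_le_one_right (by positivity) h
  have h2 := neg_le_of_abs_le h1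
  have h3 := sq_abs (x i)
  have h4 := sq_abs (y i)
  nlinarith

lemma SP_nonneg {n : ℕ} (x y φ : Fin n → ℝ) (i : Fin n) : 0 ≤ SP x y φ i := Real.sqrt_nonneg _

lemma wMean_congr {n : ℕ} (hn : 0 < n) (γ : Fin n → ℝ) (hγ : ∀ i, 0 < γ i) (f g : (Fin n → ℝ) → ℝ)
    (h : ∀ y, (∀ i, 0 ≤ y i) → f y = g y) (x : Fin n → ℝ) (r : ℝ) :
    wMean γ f x r = wMean γ g x r := by
  simp only [wMean_eq hn γ hγ]
  have : ∀ x y φ : Fin n → ℝ, f (SP x y φ) = g (SP x y φ) := fun x y φ => h _ (SP_nonneg x y φ)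
  simp only [this]

lemma wMean_bound {n : ℕ} (hn : 0 < n) (γ : Fin n → ℝ) (hγ : ∀ i, 0 < γ i) (f g : (Fin n → ℝ) → ℝ)
    (hf : Continuous f) (hg : Continuous g) (x : Fin n → ℝ) (r : ℝ) (R ε : ℝ) (hR : ∀ i, |x i| + |r| ≤ R)
    (h : ∀ y, (∀ i, 0 ≤ y i ∧ y i ≤ R) → |f y - g y| ≤ ε) :
    |wMean γ f x r - wMean γ g x r| ≤ ε := by
  have := SM_prob hn γ hγ
  have := KM_prob γ hγ
  simp only [wMean_eq hn γ hγ]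
  rw [← integral_sub (integrable_SM hn γ hγ _ (continuous_in γ hγ f hf x r)) (integrable_SM hn γ hγ _ (continuous_in γ hγ g hg x r))]
  have key : ∀ θ ∈ Metric.sphere (0 : EuclideanSpace ℝ (Fin n)) 1,
      ‖(∫ φ, f (SP x (fun i => r * θ i) φ) ∂(KM γ)) - ∫ φ, g (SP x (fun i => r * θ i) φ) ∂(KM γ)‖ ≤ ε := by
    intro θ hθ
    rw [← integral_sub (integrable_KM γ hγ _ (continuous_in2 f hf x _)) (integrable_KM γ hγ _ (continuous_in2 g hg x _))]
    refine (norm_integral_le_of_norm_le_const (C := ε) (Eventually.of_forall fun φ => ?_)).trans (by simp)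
    refine h _ fun i => ⟨SP_nonneg _ _ _ _, (SP_bound _ _ _ _).trans ((add_le_add le_rfl ?_).trans (hR i))⟩
    have h1 : ‖θ i‖ ≤ ‖θ‖ := PiLp.norm_apply_le θ i
    rw [mem_sphere_zero_iff_norm.1 hθ] at h1
    rw [abs_mul]
    exact mul_le_of_le_one_right (abs_nonneg _) h1
  rw [← SM_restrict γ, ← Real.norm_eq_abs]
  refine (norm_integral_le_of_norm_le_const (C := ε) (ae_restrict_of_forall_mem Metric.isClosed_sphere.measurableSet key)).trans ?_
  rw [SM_restrict]
  simp

/-- The iterated mean. -/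
def A1 {n : ℕ} (γ x : Fin n → ℝ) (lam mu : ℝ) (f : (Fin n → ℝ) → ℝ) : ℝ :=
  wMean γ (fun x' => wMean γ f x' mu) x lam

/-- The translated mean. -/
def A2 {n : ℕ} (γ x : Fin n → ℝ) (lam mu : ℝ) (f : (Fin n → ℝ) → ℝ) : ℝ :=
  transC ((n : ℝ) + ∑ i, γ i - 1) * ∫ φ in (0:ℝ)..π,
    wMean γ f x (Real.sqrt (lam ^ 2 + mu ^ 2 - 2 * lam * mu * Real.cos φ)) *
      Real.sin φ ^ ((n : ℝ) + ∑ i, γ i - 1 - 1)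

lemma continuous_wMean_left {n : ℕ} (hn : 0 < n) (γ : Fin n → ℝ) (hγ : ∀ i, 0 < γ i) (f : (Fin n → ℝ) → ℝ)
    (hf : Continuous f) (r : ℝ) : Continuous (fun x => wMean γ f x r) :=
  (continuous_wMean hn γ hγ f hf).comp (f := fun x : Fin n → ℝ => (x, r)) (by fun_prop)

lemma continuous_wMean_arc {n : ℕ} (hn : 0 < n) (γ : Fin n → ℝ) (hγ : ∀ i, 0 < γ i) (f : (Fin n → ℝ) → ℝ)
    (hf : Continuous f) (x : Fin n → ℝ) (lam mu : ℝ) :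
    Continuous (fun φ => wMean γ f x (Real.sqrt (lam ^ 2 + mu ^ 2 - 2 * lam * mu * Real.cos φ))) :=
  (continuous_wMean hn γ hγ f hf).comp
    (f := fun φ : ℝ => (x, Real.sqrt (lam ^ 2 + mu ^ 2 - 2 * lam * mu * Real.cos φ))) (by fun_prop)

lemma wMean_sum {n : ℕ} (hn : 0 < n) (γ : Fin n → ℝ) (hγ : ∀ i, 0 < γ i) {ι : Type*} (s : Finset ι)
    (c : ι → ℝ) (g : ι → (Fin n → ℝ) → ℝ) (hg : ∀ i, Continuous (g i)) (x : Fin n → ℝ) (r : ℝ) :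
    wMean γ (fun y => ∑ i ∈ s, c i * g i y) x r = ∑ i ∈ s, c i * wMean γ (g i) x r := by
  classical
  induction s using Finset.induction_on with
  | empty => simp [wMean_eq hn γ hγ]
  | insert a s ha ih =>
    simp only [Finset.sum_insert ha]
    rw [wMean_add hn γ hγ (fun y => c a * g a y) _ (by have := hg a; fun_prop) (by fun_prop),
      wMean_const_mul hn γ hγ, ih]

lemma A1_sum {n : ℕ} (hn : 0 < n) (γ : Fin n → ℝ) (hγ : ∀ i, 0 < γ i) {ι : Type*} (s : Finset ι)
    (c : ι → ℝ) (g : ι → (Fin n → ℝ) → ℝ) (hg : ∀ i, Continuous (g i)) (x : Fin n → ℝ) (lam mu : ℝ) :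
    A1 γ x lam mu (fun y => ∑ i ∈ s, c i * g i y) = ∑ i ∈ s, c i * A1 γ x lam mu (g i) := by
  unfold A1
  simp only [wMean_sum hn γ hγ s c g hg]
  exact wMean_sum hn γ hγ s c (fun i x' => wMean γ (g i) x' mu) (fun i => continuous_wMean_left hn γ hγ _ (hg i) mu) x lam

lemma A2_sum {n : ℕ} (hn : 0 < n) (γ : Fin n → ℝ) (hγ : ∀ i, 0 < γ i) {ι : Type*} (s : Finset ι)
    (c : ι → ℝ) (g : ι → (Fin n → ℝ) → ℝ) (hg : ∀ i, Continuous (g i)) (x : Fin n → ℝ) (lam mu : ℝ) :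
    A2 γ x lam mu (fun y => ∑ i ∈ s, c i * g i y) = ∑ i ∈ s, c i * A2 γ x lam mu (g i) := by
  unfold A2
  simp only [wMean_sum hn γ hγ s c g hg, Finset.sum_mul, mul_assoc]
  rw [intervalIntegral.integral_finsetSum, Finset.mul_sum]
  · refine Finset.sum_congr rfl fun i _ => ?_
    rw [intervalIntegral.integral_const_mul]
    ring
  · intro i _
    have := cos_pow_integrable _ (k_pos hn γ hγ) _ (continuous_wMean_arc hn γ hγ _ (hg i) x lam mu)
    simp only [mul_assoc] at this
    exact this.const_mul _

lemma wMean_TP' {n : ℕ} (hn : 0 < n) (γ η : Fin n → ℝ) (hγ : ∀ i, 0 < γ i) (N : ℕ) (x : Fin n → ℝ) (r : ℝ) :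
    wMean γ (TP γ η N) x r = PowerSeries.coeff N ((∏ i, GS (γ i) (η i) (x i)) *
      GS ((n : ℝ) + ∑ i, γ i - 1) (∑ i, η i) r) := by
  rw [wMean_TP hn γ η hγ, PowerSeries.coeff_mul]
  simp [TP, GS]

lemma A1_TP {n : ℕ} (hn : 0 < n) (γ η : Fin n → ℝ) (hγ : ∀ i, 0 < γ i) (N : ℕ) (x : Fin n → ℝ) (lam mu : ℝ) :
    A1 γ x lam mu (TP γ η N) = PowerSeries.coeff N (((∏ i, GS (γ i) (η i) (x i)) *
      GS ((n : ℝ) + ∑ i, γ i - 1) (∑ i, η i) lam) * GS ((n : ℝ) + ∑ i, γ i - 1) (∑ i, η i) mu) := by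
  unfold A1
  simp only [wMean_TP hn γ η hγ]
  have := wMean_sum hn γ hγ (Finset.HasAntidiagonal.antidiagonal N)
    (fun q => cc ((n : ℝ) + ∑ i, γ i - 1) q.2 * (∑ i, η i) ^ q.2 * (mu ^ 2) ^ q.2)
    (fun q => TP γ η q.1) (fun q => continuous_TP γ η q.1) x lam
  simp only [mul_comm (TP γ η _ _)]
  rw [this, PowerSeries.coeff_mul]
  refine Finset.sum_congr rfl fun q _ => ?_
  rw [wMean_TP' hn γ η hγ, mul_comm]
  simp [GS]

lemma A2_TP {n : ℕ} (hn : 0 < n) (γ η : Fin n → ℝ) (hγ : ∀ i, 0 < γ i) (N : ℕ) (x : Fin n → ℝ) (lam mu : ℝ) :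
    A2 γ x lam mu (TP γ η N) = PowerSeries.coeff N ((∏ i, GS (γ i) (η i) (x i)) *
      (GS ((n : ℝ) + ∑ i, γ i - 1) (∑ i, η i) lam * GS ((n : ℝ) + ∑ i, γ i - 1) (∑ i, η i) mu)) := by
  unfold A2
  have hk := k_pos hn γ hγ
  simp only [wMean_TP hn γ η hγ, Real.sq_sqrt (arg_nonneg _ _ _), Finset.sum_mul]
  rw [intervalIntegral.integral_finsetSum, Finset.mul_sum, PowerSeries.coeff_mul]
  · refine Finset.sum_congr rfl fun q _ => ?_
    have hs := star ((n : ℝ) + ∑ i, γ i - 1) hk q.2 lam mu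
    have e : PowerSeries.coeff q.2 (GS ((n : ℝ) + ∑ i, γ i - 1) (∑ i, η i) lam * GS ((n : ℝ) + ∑ i, γ i - 1) (∑ i, η i) mu)
      = (∑ i, η i) ^ q.2 * ∑ p ∈ Finset.HasAntidiagonal.antidiagonal q.2,
        (cc ((n : ℝ) + ∑ i, γ i - 1) p.1 * (lam ^ 2) ^ p.1) * (cc ((n : ℝ) + ∑ i, γ i - 1) p.2 * (mu ^ 2) ^ p.2) := by
      rw [PowerSeries.coeff_mul, Finset.mul_sum]
      refine Finset.sum_congr rfl fun p hp => ?_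
      rw [← Finset.HasAntidiagonal.mem_antidiagonal.1 hp, pow_add]
      simp only [GS, PowerSeries.coeff_mk]
      ring
    rw [e, ← hs]
    simp only [mul_assoc]
    rw [intervalIntegral.integral_const_mul, intervalIntegral.integral_const_mul, intervalIntegral.integral_const_mul]
    rw [TP]
    ring
  · intro q _
    exact cos_pow_integrable _ hk (fun φ => TP γ η q.1 x * (cc ((n : ℝ) + ∑ i, γ i - 1) q.2 * (∑ i, η i) ^ q.2 *
      (lam ^ 2 + mu ^ 2 - 2 * lam * mu * Real.cos φ) ^ q.2)) (by fun_prop)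

/-- Even monomials. -/
def mono {n : ℕ} (m : Fin n →₀ ℕ) (y : Fin n → ℝ) : ℝ := ∏ i, (y i ^ 2) ^ m i

lemma continuous_mono {n : ℕ} (m : Fin n →₀ ℕ) : Continuous (mono m) := by
  unfold mono; fun_prop

lemma A_mono {n : ℕ} (hn : 0 < n) (γ : Fin n → ℝ) (hγ : ∀ i, 0 < γ i) (m : Fin n →₀ ℕ) (x : Fin n → ℝ) (lam mu : ℝ) :
    A1 γ x lam mu (mono m) = A2 γ x lam mu (mono m) := by
  classical
  set N := ∑ i, m i with hN
  set D : (Fin n →₀ ℕ) → ℝ := fun m => (∏ i, cc (γ i) (m i)) * (A1 γ x lam mu (mono m) - A2 γ x lam mu (mono m)) with hD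
  set p : MvPolynomial (Fin n) ℝ := ∑ m ∈ (Finset.univ : Finset (Fin n)).finsuppAntidiag N, MvPolynomial.monomial m (D m) with hp
  have hp0 : p = 0 := by
    refine MvPolynomial.funext fun η => ?_
    have h := (A1_TP hn γ η hγ N x lam mu).trans ((by rw [mul_assoc]) : _ = _) |>.trans (A2_TP hn γ η hγ N x lam mu).symm
    have e : TP γ η N = fun y => ∑ m ∈ (Finset.univ : Finset (Fin n)).finsuppAntidiag N,
        (∏ i, cc (γ i) (m i) * η i ^ m i) * mono m y := by
      ext y
      rw [TP_eq]
      refine Finset.sum_congr rfl fun m _ => ?_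
      rw [mono, ← Finset.prod_mul_distrib]
    rw [e, A1_sum hn γ hγ _ _ _ (fun m => continuous_mono m), A2_sum hn γ hγ _ _ _ (fun m => continuous_mono m),
      ← sub_eq_zero, ← Finset.sum_sub_distrib] at h
    rw [map_zero, hp, map_sum, ← h]
    refine Finset.sum_congr rfl fun m _ => ?_
    rw [MvPolynomial.eval_monomial, hD, Finset.prod_mul_distrib, Finsupp.prod_fintype _ _ (by simp)]
    ring
  have hc : MvPolynomial.coeff m p = D m := by
    rw [hp, MvPolynomial.coeff_sum]
    simp only [MvPolynomial.coeff_monomial]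
    rw [Finset.sum_ite_eq' , if_pos]
    rw [Finset.mem_finsuppAntidiag]
    exact ⟨rfl, by simp⟩
  rw [hp0, MvPolynomial.coeff_zero] at hc
  have h1 : 0 < ∏ i, cc (γ i) (m i) := Finset.prod_pos fun i _ => cc_pos _ (hγ i) _
  have h2 := (mul_eq_zero.1 hc.symm).resolve_left h1.ne'
  exact sub_eq_zero.1 h2

lemma A_poly {n : ℕ} (hn : 0 < n) (γ : Fin n → ℝ) (hγ : ∀ i, 0 < γ i) (p : MvPolynomial (Fin n) ℝ) (x : Fin n → ℝ) (lam mu : ℝ) :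
    A1 γ x lam mu (fun y => MvPolynomial.eval (fun i => y i ^ 2) p)
      = A2 γ x lam mu (fun y => MvPolynomial.eval (fun i => y i ^ 2) p) := by
  have e : (fun y : Fin n → ℝ => MvPolynomial.eval (fun i => y i ^ 2) p)
      = fun y => ∑ m ∈ p.support, MvPolynomial.coeff m p * mono m y := by
    ext y
    rw [MvPolynomial.eval_eq']
    rfl
  rw [e, A1_sum hn γ hγ _ _ _ (fun m => continuous_mono m), A2_sum hn γ hγ _ _ _ (fun m => continuous_mono m)]
  exact Finset.sum_congr rfl fun m _ => by rw [A_mono hn γ hγ]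

lemma approx {n : ℕ} (f : (Fin n → ℝ) → ℝ) (hf : Continuous f) (R ε : ℝ) (hε : 0 < ε) :
    ∃ p : MvPolynomial (Fin n) ℝ, ∀ y : Fin n → ℝ, (∀ i, 0 ≤ y i ∧ y i ≤ R) →
      |f y - MvPolynomial.eval (fun i => y i ^ 2) p| ≤ ε := by
  set K : Set (Fin n → ℝ) := Set.pi Set.univ (fun _ => Set.Icc 0 R) with hK
  have : CompactSpace K := isCompact_iff_compactSpace.1 (isCompact_univ_pi fun _ => isCompact_Icc)
  set sq : Fin n → C(K, ℝ) := fun i => ⟨fun y => y.1 i ^ 2,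
    ((continuous_apply i).comp continuous_subtype_val).pow 2⟩ with hsq
  set A : Subalgebra ℝ C(K, ℝ) := (MvPolynomial.aeval sq : MvPolynomial (Fin n) ℝ →ₐ[ℝ] C(K, ℝ)).range with hA
  have hev : ∀ (p : MvPolynomial (Fin n) ℝ) (y : K), (MvPolynomial.aeval sq p) y = MvPolynomial.eval (fun i => y.1 i ^ 2) p := by
    intro p y
    induction p using MvPolynomial.induction_on with
    | C a => simp
    | add p q hp hq => simp [hp, hq]
    | mul_X p i hp =>
      rw [map_mul, map_mul, ContinuousMap.mul_apply, hp, MvPolynomial.aeval_X, MvPolynomial.eval_X]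
      rfl
  have hsep : A.SeparatesPoints := by
    intro y z hyz
    have : ∃ i, y.1 i ≠ z.1 i := by
      by_contra hcon
      push Not at hcon
      exact hyz (Subtype.ext (funext hcon))
    obtain ⟨i, hi⟩ := this
    refine ⟨sq i, ⟨sq i, ⟨MvPolynomial.X i, by simp⟩, rfl⟩, ?_⟩
    intro h
    have h' : y.1 i ^ 2 = z.1 i ^ 2 := h
    exact hi ((sq_eq_sq₀ (y.2 i (mem_univ _)).1 (z.2 i (mem_univ _)).1).1 h')
  obtain ⟨⟨g, p, hp⟩, hg⟩ := ContinuousMap.exists_mem_subalgebra_near_continuous_of_separatesPoints A hsep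
    (fun y : K => f y.1) (by fun_prop) ε hε
  refine ⟨p, fun y hy => ?_⟩
  have h1 := hg ⟨y, fun i _ => hy i⟩
  have h2 := hev p ⟨y, fun i _ => hy i⟩
  rw [abs_sub_comm, ← h2]
  refine le_of_lt ?_
  subst hp
  exact h1

lemma sin_norm (ν : ℝ) (hν : 0 < ν) : transC ν * ∫ φ in (0:ℝ)..π, Real.sin φ ^ (ν - 1) = 1 := by
  have h := cos_moment_norm ν hν 0
  have h3 : 0 < Real.Gamma ((ν + 1) / 2) := Real.Gamma_pos_of_pos (by positivity)
  simp [cc, h3.ne'] at h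
  exact h

lemma A_eq {n : ℕ} (hn : 0 < n) (γ : Fin n → ℝ) (hγ : ∀ i, 0 < γ i) (f : (Fin n → ℝ) → ℝ) (hf : Continuous f)
    (x : Fin n → ℝ) (lam mu : ℝ) :
    A1 γ x lam mu f = A2 γ x lam mu f := by
  have hk := k_pos hn γ hγ
  have main : ∀ ε : ℝ, 0 < ε → |A1 γ x lam mu f - A2 γ x lam mu f| ≤ 2 * ε := by
    intro ε hε
    set R := (∑ i, |x i|) + |lam| + |mu| with hR
    have hxi : ∀ i, |x i| ≤ ∑ i, |x i| := fun i =>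
      Finset.single_le_sum (f := fun i => |x i|) (fun i _ => abs_nonneg _) (Finset.mem_univ i)
    obtain ⟨p, hp⟩ := approx f hf R ε hε
    set q : (Fin n → ℝ) → ℝ := fun y => MvPolynomial.eval (fun i => y i ^ 2) p with hq
    have hqc : Continuous q := by
      have e : q = fun y => ∑ m ∈ p.support, MvPolynomial.coeff m p * mono m y := by
        ext y
        change MvPolynomial.eval (fun i => y i ^ 2) p = _
        rw [MvPolynomial.eval_eq']
        rfl
      rw [e]
      have := fun m : Fin n →₀ ℕ => continuous_mono m
      fun_prop
    have h1 : |A1 γ x lam mu f - A1 γ x lam mu q| ≤ ε := by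
      refine wMean_bound hn γ hγ _ _ (continuous_wMean_left hn γ hγ f hf mu) (continuous_wMean_left hn γ hγ q hqc mu)
        x lam (R - |mu|) ε (fun i => ?_) fun y hy => ?_
      · have := hxi i
        rw [hR]; linarith
      · refine wMean_bound hn γ hγ _ _ hf hqc y mu R ε (fun i => ?_) hp
        rw [abs_of_nonneg (hy i).1]
        have := (hy i).2
        linarith
    have h2 : |A2 γ x lam mu f - A2 γ x lam mu q| ≤ ε := by
      unfold A2
      rw [← mul_sub, ← intervalIntegral.integral_sub
        (cos_pow_integrable _ hk _ (continuous_wMean_arc hn γ hγ _ hf x lam mu))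
        (cos_pow_integrable _ hk _ (continuous_wMean_arc hn γ hγ _ hqc x lam mu)), abs_mul, abs_of_pos (transC_pos _ hk)]
      have h3 : ‖∫ φ in (0:ℝ)..π, (wMean γ f x (Real.sqrt (lam ^ 2 + mu ^ 2 - 2 * lam * mu * Real.cos φ)) *
            Real.sin φ ^ ((n : ℝ) + ∑ i, γ i - 1 - 1) - wMean γ q x (Real.sqrt (lam ^ 2 + mu ^ 2 - 2 * lam * mu * Real.cos φ)) *
            Real.sin φ ^ ((n : ℝ) + ∑ i, γ i - 1 - 1))‖ ≤ ∫ φ in (0:ℝ)..π, ε * Real.sin φ ^ ((n : ℝ) + ∑ i, γ i - 1 - 1) := by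
        refine intervalIntegral.norm_integral_le_of_norm_le Real.pi_pos.le (Eventually.of_forall fun φ hφ => ?_)
          (cos_pow_integrable _ hk (fun _ => ε) continuous_const)
        have hs : 0 ≤ Real.sin φ ^ ((n : ℝ) + ∑ i, γ i - 1 - 1) :=
          Real.rpow_nonneg (Real.sin_nonneg_of_nonneg_of_le_pi hφ.1.le hφ.2) _
        rw [← sub_mul, norm_mul, Real.norm_of_nonneg hs]
        refine mul_le_mul_of_nonneg_right ?_ hs
        refine wMean_bound hn γ hγ _ _ hf hqc x _ R ε (fun i => ?_) hp
        have hb := SP_bound (fun _ : Fin n => lam) (fun _ => mu) (fun _ => φ) i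
        unfold SP at hb
        rw [abs_of_nonneg (Real.sqrt_nonneg _)]
        have := hxi i
        rw [hR]
        linarith
      rw [intervalIntegral.integral_const_mul] at h3
      have h4 := sin_norm _ hk
      calc _ ≤ transC ((n : ℝ) + ∑ i, γ i - 1) * (ε * ∫ φ in (0:ℝ)..π, Real.sin φ ^ ((n : ℝ) + ∑ i, γ i - 1 - 1)) :=
            mul_le_mul_of_nonneg_left h3 (transC_pos _ hk).le
        _ = ε := by linear_combination ε * h4
    have h3 := A_poly hn γ hγ p x lam mu
    rw [← hq] at h3
    rw [h3] at h1
    have := abs_sub_le (A1 γ x lam mu f) (A2 γ x lam mu q) (A2 γ x lam mu f)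
    rw [abs_sub_comm (A2 γ x lam mu q)] at this
    linarith
  by_contra hne
  have hpos : 0 < |A1 γ x lam mu f - A2 γ x lam mu f| := abs_pos.2 (sub_ne_zero.2 hne)
  have := main (|A1 γ x lam mu f - A2 γ x lam mu f| / 4) (by positivity)
  linarith

lemma change_var (lam mu : ℝ) (hmu : 0 < mu) (hlm : mu ≤ lam) (k : ℝ) (g : ℝ → ℝ) :
    ∫ r in (lam - mu)..(lam + mu),
            ((lam ^ 2 - (r - mu) ^ 2) * ((r + mu) ^ 2 - lam ^ 2)) ^ ((k - 3) / 2) * g r * r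
      = (2 * lam * mu) ^ (k - 2) / 2 * ∫ φ in (0:ℝ)..π,
        g (Real.sqrt (lam ^ 2 + mu ^ 2 - 2 * lam * mu * Real.cos φ)) * Real.sin φ ^ (k - 2) := by
  have hlam : 0 < lam := hmu.trans_le hlm
  have hlm0 : 0 < lam * mu := mul_pos hlam hmu
  set ρ : ℝ → ℝ := fun φ => Real.sqrt (lam ^ 2 + mu ^ 2 - 2 * lam * mu * Real.cos φ) with hρ
  have hcos : ∀ φ ∈ Ioo (0:ℝ) π, -1 < Real.cos φ ∧ Real.cos φ < 1 := by
    intro φ hφ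
    have hs := Real.sin_pos_of_mem_Ioo hφ
    have h1 := Real.sin_sq_add_cos_sq φ
    have h2 := Real.cos_le_one φ
    have h3 := Real.neg_one_le_cos φ
    constructor
    · rcases h3.lt_or_eq with h | h
      · exact h
      · rw [← h] at h1; nlinarith
    · rcases h2.lt_or_eq with h | h
      · exact h
      · rw [h] at h1; nlinarith
  have harg : ∀ φ ∈ Ioo (0:ℝ) π, (lam - mu) ^ 2 < lam ^ 2 + mu ^ 2 - 2 * lam * mu * Real.cos φ ∧
      lam ^ 2 + mu ^ 2 - 2 * lam * mu * Real.cos φ < (lam + mu) ^ 2 := by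
    intro φ hφ
    obtain ⟨h1, h2⟩ := hcos φ hφ
    constructor <;> nlinarith
  have hpos : ∀ φ ∈ Ioo (0:ℝ) π, 0 < lam ^ 2 + mu ^ 2 - 2 * lam * mu * Real.cos φ := fun φ hφ =>
    (sq_nonneg _).trans_lt (harg φ hφ).1
  have himg : ρ '' Ioo 0 π = Ioo (lam - mu) (lam + mu) := by
    ext r
    constructor
    · rintro ⟨φ, hφ, rfl⟩
      exact ⟨Real.lt_sqrt_of_sq_lt (harg φ hφ).1, (Real.sqrt_lt' (by linarith)).2 (harg φ hφ).2⟩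
    · rintro ⟨h1, h2⟩
      have hr : 0 < r := by linarith
      set c := (lam ^ 2 + mu ^ 2 - r ^ 2) / (2 * lam * mu) with hc
      have hc1 : -1 < c := by
        rw [hc, lt_div_iff₀ (by positivity)]
        nlinarith
      have hc2 : c < 1 := by
        rw [hc, div_lt_iff₀ (by positivity)]
        nlinarith
      refine ⟨Real.arccos c, ⟨Real.arccos_pos.2 hc2, ?_⟩, ?_⟩
      · refine lt_of_le_of_ne (Real.arccos_le_pi _) fun h => ?_
        rw [Real.arccos_eq_pi] at h
        linarith
      · have e : lam ^ 2 + mu ^ 2 - 2 * lam * mu * Real.cos (Real.arccos c) = r ^ 2 := by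
          rw [Real.cos_arccos hc1.le hc2.le, hc]
          field_simp
          ring
        change Real.sqrt _ = r
        rw [e, Real.sqrt_sq hr.le]
  have hinj : InjOn ρ (Ioo 0 π) := by
    intro a ha b hb hab
    have h1 := (Real.sqrt_inj (hpos a ha).le (hpos b hb).le).1 hab
    refine Real.injOn_cos (Ioo_subset_Icc_self ha) (Ioo_subset_Icc_self hb) ?_
    have : 2 * (lam * mu) * (Real.cos a - Real.cos b) = 0 := by linarith
    rcases mul_eq_zero.1 this with h | h <;> linarith
  have hder : ∀ φ ∈ Ioo (0:ℝ) π, HasDerivWithinAt ρ (lam * mu * Real.sin φ / ρ φ) (Ioo 0 π) φ := by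
    intro φ hφ
    have h1 : HasDerivAt (fun φ => lam ^ 2 + mu ^ 2 - 2 * lam * mu * Real.cos φ)
        (2 * lam * mu * Real.sin φ) φ := by
      have := ((Real.hasDerivAt_cos φ).const_mul (2 * lam * mu)).const_sub (lam ^ 2 + mu ^ 2)
      exact this.congr_deriv (by ring)
    have h2 := h1.sqrt (hpos φ hφ).ne'
    refine HasDerivAt.hasDerivWithinAt (h2.congr_deriv ?_)
    rw [hρ]
    have h3 : 0 < Real.sqrt (lam ^ 2 + mu ^ 2 - 2 * lam * mu * Real.cos φ) := Real.sqrt_pos.2 (hpos φ hφ)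
    field_simp
  rw [intervalIntegral.integral_of_le (by linarith), integral_Ioc_eq_integral_Ioo, ← himg,
    integral_image_eq_integral_abs_deriv_smul measurableSet_Ioo hder hinj,
    intervalIntegral.integral_of_le Real.pi_pos.le, integral_Ioc_eq_integral_Ioo, ← integral_const_mul]
  refine setIntegral_congr_fun measurableSet_Ioo fun φ hφ => ?_
  have hs := Real.sin_pos_of_mem_Ioo hφ
  have h3 : 0 < ρ φ := Real.sqrt_pos.2 (hpos φ hφ)
  have hsq : ρ φ ^ 2 = lam ^ 2 + mu ^ 2 - 2 * lam * mu * Real.cos φ := Real.sq_sqrt (hpos φ hφ).le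
  have h1 := Real.sin_sq_add_cos_sq φ
  have hW : (lam ^ 2 - (ρ φ - mu) ^ 2) * ((ρ φ + mu) ^ 2 - lam ^ 2) = ((2 * lam * mu) * Real.sin φ) ^ 2 := by
    have : (lam ^ 2 - (ρ φ - mu) ^ 2) * ((ρ φ + mu) ^ 2 - lam ^ 2)
      = (2 * lam * mu) ^ 2 - (lam ^ 2 + mu ^ 2 - ρ φ ^ 2) ^ 2 := by ring
    rw [this, hsq]
    linear_combination (2 * lam * mu) ^ 2 * (-h1)
  have hb : 0 < 2 * lam * mu := by positivity
  have hbs : 0 < (2 * lam * mu) * Real.sin φ := by positivity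
  have e1 : (((2 * lam * mu) * Real.sin φ) ^ 2) ^ ((k - 3) / 2) * ((2 * lam * mu) * Real.sin φ)
      = (2 * lam * mu) ^ (k - 2) * Real.sin φ ^ (k - 2) := by
    rw [← Real.mul_rpow hb.le hs.le, ← Real.rpow_natCast, ← Real.rpow_mul hbs.le,
      ← Real.rpow_add_one hbs.ne']
    congr 1
    push_cast
    ring
  have h4 : 0 ≤ lam * mu * Real.sin φ / ρ φ := by positivity
  change |lam * mu * Real.sin φ / ρ φ| • (((lam ^ 2 - (ρ φ - mu) ^ 2) * ((ρ φ + mu) ^ 2 - lam ^ 2)) ^ ((k - 3) / 2) * g (ρ φ) * ρ φ)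
    = (2 * lam * mu) ^ (k - 2) / 2 * (g (ρ φ) * Real.sin φ ^ (k - 2))
  rw [abs_of_nonneg h4, hW, smul_eq_mul]
  have h5 : lam * mu * Real.sin φ / ρ φ * ρ φ = lam * mu * Real.sin φ := div_mul_cancel₀ _ h3.ne'
  linear_combination ((((2 * lam * mu) * Real.sin φ) ^ 2) ^ ((k - 3) / 2) * g (ρ φ)) * h5 + g (ρ φ) / 2 * e1

lemma wMean_zero_dim (γ : Fin 0 → ℝ) (f : (Fin 0 → ℝ) → ℝ) (x : Fin 0 → ℝ) (r : ℝ) : wMean γ f x r = 0 := by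
  have hE : IsEmpty (Metric.sphere (0 : EuclideanSpace ℝ (Fin 0)) 1) := by
    constructor
    rintro ⟨θ, hθ⟩
    rw [mem_sphere_zero_iff_norm, Subsingleton.elim θ 0, norm_zero] at hθ
    exact zero_ne_one hθ
  have : sphereMeasure 0 = 0 := by
    unfold sphereMeasure
    rw [Measure.eq_zero_of_isEmpty ((volume : Measure (EuclideanSpace ℝ (Fin 0))).toSphere)]
    simp
  simp [wMean, this]

/-- For `f` continuous on the closure of `ℝ^n_+`, even in each variable and
integrable with weight `x^γ`, and `λ ≥ μ > 0`, the iterated weighted spherical mean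
`I^γ_f(x;λ,μ) = M^γ_λ[M^γ_μ[f(x)]]` is expressed through a single integral of the weighted
spherical mean:
`I^γ_f(x;λ,μ) = [2Γ((n+|γ|)/2)/(√π Γ((n+|γ|-1)/2))] (2λμ)^{-(n+|γ|-2)}
  ∫_{λ-μ}^{λ+μ} [(λ²-(r-μ)²)((r+μ)²-λ²)]^{(n+|γ|-3)/2} M^γ_f(x;r) r dr`. -/
theorem iterated_weighted_spherical_mean_formula
    (n : ℕ) (γ : Fin n → ℝ) (hγ : ∀ i, 0 < γ i)
    (f : (Fin n → ℝ) → ℝ)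
    (hf : ContinuousOn f {x | ∀ i, 0 ≤ x i})
    (heven : ∀ (i : Fin n) (x : Fin n → ℝ), f (Function.update x i (-(x i))) = f x)
    (hint : MeasureTheory.IntegrableOn (fun x => f x * ∏ i, x i ^ γ i) {x | ∀ i, 0 < x i})
    (x : Fin n → ℝ) (hx : ∀ i, 0 < x i)
    (lam mu : ℝ) (hmu : 0 < mu) (hlm : mu ≤ lam) :
    wMean γ (fun x' => wMean γ f x' mu) x lam
      = 2 * Real.Gamma (((n : ℝ) + ∑ i, γ i) / 2)
          / (Real.sqrt π * Real.Gamma (((∑ i, γ i) + (n : ℝ) - 1) / 2))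
        * (2 * lam * mu) ^ (-((n : ℝ) + (∑ i, γ i) - 2))
        * ∫ r in (lam - mu)..(lam + mu),
            ((lam ^ 2 - (r - mu) ^ 2) * ((r + mu) ^ 2 - lam ^ 2))
                ^ (((n : ℝ) + (∑ i, γ i) - 3) / 2)
              * wMean γ f x r * r := by
  rcases Nat.eq_zero_or_pos n with h0 | hn
  · subst h0
    simp [wMean_zero_dim]
  set F : (Fin n → ℝ) → ℝ := fun y => f (fun i => |y i|) with hF
  have hFc : Continuous F :=
    hf.comp_continuous (f := fun y : Fin n → ℝ => fun i => |y i|) (by fun_prop) fun y i => abs_nonneg _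
  have hfF : ∀ y r, wMean γ f y r = wMean γ F y r := fun y r =>
    wMean_congr hn γ hγ f F (fun z hz => by
      simp only [hF]
      congr 1
      ext i
      exact (abs_of_nonneg (hz i)).symm) y r
  simp only [hfF]
  have hA := A_eq hn γ hγ F hFc x lam mu
  unfold A1 A2 at hA
  rw [hA, change_var lam mu hmu hlm ((n : ℝ) + ∑ i, γ i) (fun r => wMean γ F x r)]
  have hb : 0 < 2 * lam * mu := by
    have : 0 < lam := hmu.trans_le hlm
    positivity
  rw [transC, Real.rpow_neg hb.le]
  have hp : (2 * lam * mu) ^ ((n : ℝ) + (∑ i, γ i) - 2) ≠ 0 := (Real.rpow_pos_of_pos hb _).ne'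
  rw [show (n : ℝ) + ∑ i, γ i - 1 + 1 = (n : ℝ) + ∑ i, γ i by ring,
    show (∑ i, γ i) + (n : ℝ) - 1 = (n : ℝ) + ∑ i, γ i - 1 by ring,
    show (n : ℝ) + ∑ i, γ i - 1 - 1 = (n : ℝ) + ∑ i, γ i - 2 by ring]
  generalize (∫ φ in (0:ℝ)..π, wMean γ F x (Real.sqrt (lam ^ 2 + mu ^ 2 - 2 * lam * mu * Real.cos φ)) *
    Real.sin φ ^ ((n : ℝ) + ∑ i, γ i - 2)) = I
  generalize (2 * lam * mu) ^ ((n : ℝ) + (∑ i, γ i) - 2) = P at *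
  have e : P⁻¹ * P = 1 := inv_mul_cancel₀ hp
  rw [mul_div_assoc]
  generalize Real.Gamma (((n : ℝ) + ∑ i, γ i) / 2) / (Real.sqrt π * Real.Gamma (((n : ℝ) + ∑ i, γ i - 1) / 2)) = T
  linear_combination (-(T * I)) * e
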